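/- arXiv:2604.27535 — 7 statements merged into one kernel-verified Lean document; each statement's English description precedes it below -/
import Mathlib

section
/- Let n ≥ 3 and let 𝒢 = {G_1, …, G_n} be a family of n graphs (not necessarily distinct) on a common vertex set V with |V| = n, with σ(𝒢) ≥ n. Let C_n = x_1 x_2 ⋯ x_n x_1 be a rainbow Hamiltonian cycle with x_i x_{i+1} ∈ E(G_i) for each i ∈ [n] (indices modulo n), and suppose there is no rainbow cycle of length n − 1 in 𝒢 containing x_1. Then n is even and for every a ∈ [n] and every i ∈ [n], the neighborhood of x_i in G_a is exactly {x_j : j ∈ [n], j and i have opposite parity}; in particular G_1 = ⋯ = G_n = K_{n/2,n/2}. -/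
/-- `c`, `φ` encode a rainbow cycle of length `ℓ` in the graph family `G`:
`c` lists the vertices of the cycle in cyclic order (injectively), and `φ`
injectively assigns to the edge `c i — c (i+1)` a member of the family
containing it. -/
def IsRainbowCycle {V ι : Type*} {ℓ : ℕ} (G : ι → SimpleGraph V)
    (c : ZMod ℓ → V) (φ : ZMod ℓ → ι) : Prop :=
  Function.Injective c ∧ Function.Injective φ ∧
    ∀ i : ZMod ℓ, (G (φ i)).Adj (c i) (c (i + 1))

/-- The family `G` contains a rainbow cycle of length `ℓ`. -/
def HasRainbowCycle {V ι : Type*} (G : ι → SimpleGraph V) (ℓ : ℕ) : Prop :=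
  ∃ (c : ZMod ℓ → V) (φ : ZMod ℓ → ι), IsRainbowCycle G c φ

/-- The family `G` contains a rainbow cycle of length `ℓ` passing through `x`. -/
def HasRainbowCycleThrough {V ι : Type*} (G : ι → SimpleGraph V) (ℓ : ℕ) (x : V) : Prop :=
  ∃ (c : ZMod ℓ → V) (φ : ZMod ℓ → ι), IsRainbowCycle G c φ ∧ ∃ i, c i = x


theorem build_cycle {V ι : Type*} (G : ι → SimpleGraph V) (m : ℕ) (hm : 2 ≤ m)
    (v : ℕ → V) (g : ℕ → ι)
    (hv : ∀ a b, a < m → b < m → v a = v b → a = b)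
    (hg : ∀ a b, a < m → b < m → g a = g b → a = b)
    (he : ∀ k, k + 1 < m → (G (g k)).Adj (v k) (v (k + 1)))
    (hl : (G (g (m - 1))).Adj (v (m - 1)) (v 0)) (x : V) (hx : ∃ k, k < m ∧ v k = x) :
    HasRainbowCycleThrough G m x := by
  haveI : NeZero m := ⟨by omega⟩
  haveI : Fact (1 < m) := ⟨by omega⟩
  refine ⟨fun k => v k.val, fun k => g k.val, ⟨?_, ?_, ?_⟩, ?_⟩
  · intro a b h
    exact ZMod.val_injective m (hv _ _ (ZMod.val_lt a) (ZMod.val_lt b) h)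
  · intro a b h
    exact ZMod.val_injective m (hg _ _ (ZMod.val_lt a) (ZMod.val_lt b) h)
  · intro i
    have hi := ZMod.val_lt i
    have h1 : (i + 1).val = (i.val + 1) % m := by
      rw [ZMod.val_add, ZMod.val_one]
    by_cases h : i.val + 1 < m
    · have h2 : (i + 1).val = i.val + 1 := by rw [h1, Nat.mod_eq_of_lt h]
      simp only [h2]
      exact he _ h
    · have h3 : i.val + 1 = m := by omega
      have h2 : (i + 1).val = 0 := by rw [h1, h3, Nat.mod_self]
      have h4 : i.val = m - 1 := by omega
      simp only [h2, h4]
      exact hl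
  · obtain ⟨k, hk, rfl⟩ := hx
    exact ⟨(k : ZMod m), by simp only [ZMod.val_natCast, Nat.mod_eq_of_lt hk]⟩

/-- Path version of the Ore-type counting. -/
theorem path_core {V ι : Type*} [Fintype V] {n : ℕ} (m : ℕ) (hm : 2 ≤ m) (hmn : n = m + 1)
    (G : ι → SimpleGraph V) [∀ i, DecidableRel (G i).Adj]
    (hσ : ∀ u v : V, u ≠ v → (∃ i, ¬ (G i).Adj u v) →
      ∀ p q, n ≤ (G p).degree u + (G q).degree v)
    (w : ℕ → V) (g : ℕ → ι) (z : V) (q : ι) (x : V)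
    (hw : ∀ a b, a < m → b < m → w a = w b → a = b)
    (hg : ∀ a b, a < m → b < m → g a = g b → a = b)
    (hq : ∀ a, a < m → g a ≠ q)
    (hcov : ∀ v, v = z ∨ ∃ k, k < m ∧ v = w k)
    (he : ∀ k, k + 1 < m → (G (g k)).Adj (w k) (w (k + 1)))
    (hx : ∃ k, k < m ∧ w k = x)
    (hno : ¬ HasRainbowCycleThrough G m x) :
    ¬ (G (g (m-1))).Adj (w (m-1)) (w 0) ∧
    (G (g (m-1))).Adj (w 0) z ∧ (G q).Adj (w (m-1)) z ∧
    ∀ j, j + 1 < m → ((G (g (m-1))).Adj (w 0) (w (j+1)) ↔ ¬ (G q).Adj (w (m-1)) (w j)) := by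
  classical
  set p := g (m-1) with hp
  have h0 : ¬ (G p).Adj (w (m-1)) (w 0) := fun h =>
    hno (build_cycle G m hm w g hw hg he h x hx)
  have hne : w 0 ≠ w (m-1) := fun h => by
    have := hw _ _ (by omega) (by omega) h
    omega
  have hrot : ∀ j, j + 1 < m → (G p).Adj (w 0) (w (j+1)) → ¬ (G q).Adj (w (m-1)) (w j) := by
    intro j hj h1 h2
    apply hno
    refine build_cycle G m hm (fun k => if k ≤ j then w k else w (m + j - k))
      (fun k => if k < j then g k else if k = j then q else if k = m - 1 then p
        else g (m + j - k - 1)) ?_ ?_ ?_ ?_ x ?_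
    · intro a b ha hb h
      split_ifs at h <;> have := hw _ _ (by omega) (by omega) h <;> omega
    · intro a b ha hb h
      split_ifs at h
      all_goals first
        | omega
        | exact absurd h (hq _ (by omega))
        | exact absurd h.symm (hq _ (by omega))
        | (have := hg _ _ (by omega) (by omega) h; omega)
    · intro k hk
      rcases lt_trichotomy k j with h | h | h
      · rw [if_pos (by omega), if_pos (by omega), if_pos (by omega)]
        exact he k hk
      · subst h
        rw [if_neg (by omega), if_pos rfl, if_pos le_rfl, if_neg (by omega)]
        have : m + k - (k+1) = m - 1 := by omega
        rw [this]
        exact h2.symm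
      · rw [if_neg (by omega), if_neg (by omega), if_neg (by omega), if_neg (by omega),
          if_neg (by omega)]
        have e1 : m + j - k = (m + j - k - 1) + 1 := by omega
        have e2 : m + j - (k + 1) = m + j - k - 1 := by omega
        rw [e2]
        have := (he (m + j - k - 1) (by omega)).symm
        rwa [← e1] at this
    · skip
      rw [if_neg (by omega), if_neg (by omega), if_pos rfl, if_neg (by omega), if_pos (by omega)]
      have : m + j - (m - 1) = j + 1 := by omega
      rw [this]
      exact h1.symm
    · obtain ⟨k, hk, rfl⟩ := hx
      by_cases h : k ≤ j
      · exact ⟨k, hk, by simp [h]⟩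
      · refine ⟨m + j - k, by omega, ?_⟩
        rw [if_neg (by omega)]
        congr 1
        omega
  have hdeg := hσ (w 0) (w (m-1)) hne ⟨p, fun h => h0 h.symm⟩ p q
  set A := (Finset.range (m-1)).filter (fun j => (G p).Adj (w 0) (w (j+1))) with hA
  set B := (Finset.range (m-1)).filter (fun j => (G q).Adj (w (m-1)) (w j)) with hB
  have hdisj : Disjoint A B := by
    rw [Finset.disjoint_left]
    intro j hjA hjB
    simp only [hA, hB, Finset.mem_filter, Finset.mem_range] at hjA hjB
    exact hrot j (by omega) hjA.2 hjB.2
  have hsub : A ∪ B ⊆ Finset.range (m-1) :=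
    Finset.union_subset (Finset.filter_subset _ _) (Finset.filter_subset _ _)
  have hcard : A.card + B.card ≤ m - 1 := by
    rw [← Finset.card_union_of_disjoint hdisj]
    simpa using Finset.card_le_card hsub
  have hdA : (G p).degree (w 0) ≤ A.card + (if (G p).Adj (w 0) z then 1 else 0) := by
    rw [← SimpleGraph.card_neighborFinset_eq_degree]
    have : (G p).neighborFinset (w 0) ⊆
        A.image (fun j => w (j+1)) ∪ (if (G p).Adj (w 0) z then {z} else ∅) := by
      intro v hv
      rw [SimpleGraph.mem_neighborFinset] at hv
      rw [Finset.mem_union]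
      rcases hcov v with rfl | ⟨k, hk, rfl⟩
      · right; simp [hv]
      · left
        rcases Nat.eq_zero_or_pos k with rfl | hk0
        · exact absurd hv (SimpleGraph.irrefl _)
        · obtain ⟨k, rfl⟩ : ∃ l, k = l + 1 := ⟨k-1, by omega⟩
          exact Finset.mem_image.2 ⟨k, by simp [hA, hv]; omega, rfl⟩
    refine (Finset.card_le_card this).trans ((Finset.card_union_le _ _).trans ?_)
    apply Nat.add_le_add Finset.card_image_le
    split_ifs <;> simp
  have hdB : (G q).degree (w (m-1)) ≤ B.card + (if (G q).Adj (w (m-1)) z then 1 else 0) := by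
    rw [← SimpleGraph.card_neighborFinset_eq_degree]
    have : (G q).neighborFinset (w (m-1)) ⊆
        B.image w ∪ (if (G q).Adj (w (m-1)) z then {z} else ∅) := by
      intro v hv
      rw [SimpleGraph.mem_neighborFinset] at hv
      rw [Finset.mem_union]
      rcases hcov v with rfl | ⟨k, hk, rfl⟩
      · right; simp [hv]
      · left
        by_cases hk0 : k = m - 1
        · subst hk0; exact absurd hv (SimpleGraph.irrefl _)
        · exact Finset.mem_image.2 ⟨k, by simp [hB, hv]; omega, rfl⟩
    refine (Finset.card_le_card this).trans ((Finset.card_union_le _ _).trans ?_)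
    apply Nat.add_le_add Finset.card_image_le
    split_ifs <;> simp
  have ha : (G p).Adj (w 0) z := by
    by_contra h
    rw [if_neg h] at hdA
    split_ifs at hdB <;> omega
  have hb : (G q).Adj (w (m-1)) z := by
    by_contra h
    rw [if_neg h] at hdB
    split_ifs at hdA <;> omega
  rw [if_pos ha] at hdA
  rw [if_pos hb] at hdB
  have hU : A ∪ B = Finset.range (m-1) := by
    apply Finset.eq_of_subset_of_card_le hsub
    rw [Finset.card_union_of_disjoint hdisj, Finset.card_range]
    omega
  refine ⟨h0, ha, hb, fun j hj => ⟨hrot j hj, fun h => ?_⟩⟩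
  have hj' : j ∈ A ∪ B := by rw [hU]; simp; omega
  rcases Finset.mem_union.1 hj' with h' | h'
  · exact (Finset.mem_filter.1 h').2
  · exact absurd (Finset.mem_filter.1 h').2 h

/-- Cyclic version. -/
theorem cyc_core {V : Type*} [Fintype V] {n : ℕ} (hn : 3 ≤ n)
    (G : ZMod n → SimpleGraph V) [∀ i, DecidableRel (G i).Adj]
    (hσ : ∀ u v : V, u ≠ v → (∃ i, ¬ (G i).Adj u v) →
      ∀ p q, n ≤ (G p).degree u + (G q).degree v)
    (c : ZMod n → V) (hc : Function.Bijective c)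
    (hno : ¬ HasRainbowCycleThrough G (n - 1) (c 1))
    (i : ZMod n) (hi : i ≠ 1) (ψ : ZMod n → ZMod n) (hψ : Function.Injective ψ)
    (hval : ∀ k, k ≠ i - 1 → k ≠ i → (G (ψ k)).Adj (c k) (c (k+1))) :
    (G (ψ (i-1))).Adj (c i) (c (i+1)) ∧ (G (ψ i)).Adj (c (i-1)) (c i) ∧
    ∀ j, j ≠ i - 1 → j ≠ i →
      ((G (ψ (i-1))).Adj (c (i+1)) (c (j+1)) ↔ ¬ (G (ψ i)).Adj (c (i-1)) (c j)) := by
  haveI : NeZero n := ⟨by omega⟩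
  obtain ⟨m, rfl⟩ : ∃ m, n = m + 1 := ⟨n-1, by omega⟩
  rw [Nat.add_sub_cancel] at hno
  have hcast : ∀ a b : ℕ, a ≤ m → b ≤ m → (a : ZMod (m+1)) = b → a = b := by
    intro a b ha hb h
    have := (ZMod.natCast_eq_natCast_iff' a b (m+1)).1 h
    rwa [Nat.mod_eq_of_lt (by omega), Nat.mod_eq_of_lt (by omega)] at this
  have hrep : ∀ j : ZMod (m+1), j ≠ i → ∃ k, k < m ∧ j = i + ((k+1 : ℕ) : ZMod (m+1)) := by
    intro j hj
    have h1 : (j - i).val ≠ 0 := by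
      rw [Ne, ZMod.val_eq_zero, sub_eq_zero]; exact hj
    have h2 := ZMod.val_lt (j - i)
    refine ⟨(j-i).val - 1, by omega, ?_⟩
    rw [Nat.sub_add_cancel (by omega), ZMod.natCast_zmod_val]
    ring
  have hlast : i + ((m - 1 + 1 : ℕ) : ZMod (m+1)) = i - 1 := by
    rw [Nat.sub_add_cancel (by omega)]
    have : ((m + 1 : ℕ) : ZMod (m+1)) = 0 := ZMod.natCast_self _
    push_cast at this
    rw [eq_sub_iff_add_eq, add_assoc, this, add_zero]
  have inj1 : ∀ a b, a < m → b < m →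
      i + ((a+1 : ℕ) : ZMod (m+1)) = i + ((b+1 : ℕ) : ZMod (m+1)) → a = b := by
    intro a b ha hb h
    have := hcast _ _ (by omega) (by omega) (add_left_cancel h)
    omega
  have hnz : ∀ a, a < m → i + ((a+1 : ℕ) : ZMod (m+1)) ≠ i := by
    intro a ha h
    have : ((a+1 : ℕ) : ZMod (m+1)) = ((0:ℕ) : ZMod (m+1)) := by
      simpa using h
    have := hcast _ _ (by omega) (by omega) this
    omega
  have key := path_core m (by omega) rfl G hσ (fun k => c (i + ((k+1 : ℕ) : ZMod (m+1))))
    (fun k => ψ (i + ((k+1 : ℕ) : ZMod (m+1)))) (c i) (ψ i) (c 1)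
    (fun a b ha hb h => inj1 a b ha hb (hc.1 h))
    (fun a b ha hb h => inj1 a b ha hb (hψ h))
    (fun a ha h => hnz a ha (hψ h))
    (by
      intro v
      obtain ⟨j, rfl⟩ := hc.2 v
      by_cases h : j = i
      · left; rw [h]
      · right
        obtain ⟨k, hk, h⟩ := hrep j h
        exact ⟨k, hk, by rw [h]⟩)
    (by
      intro k hk
      have := hval (i + ((k+1 : ℕ) : ZMod (m+1))) (by
        rw [← hlast]; intro h
        have := inj1 _ _ (by omega) (by omega) h
        omega) (hnz k (by omega))
      convert this using 2
      push_cast; ring)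
    (by
      obtain ⟨k, hk, h⟩ := hrep 1 hi.symm
      exact ⟨k, hk, by rw [← h]⟩)
    hno
  rw [hlast] at key
  obtain ⟨-, k1, k2, k3⟩ := key
  have e0 : i + ((0+1 : ℕ) : ZMod (m+1)) = i + 1 := by simp
  rw [e0] at k1
  refine ⟨k1.symm, k2, fun j hj1 hj2 => ?_⟩
  obtain ⟨k, hk, rfl⟩ := hrep j hj2
  have hk' : k + 1 < m := by
    by_contra h
    apply hj1
    rw [← hlast]
    congr 3
    omega
  have := k3 k hk'
  rw [e0] at this
  convert this using 3
  push_cast; ring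

theorem comb {n : ℕ} (hn : 3 ≤ n) (M : ℕ → ℕ → Prop)
    (hsymm : ∀ a b, M a b → M b a) (hper : ∀ a b, M a (b + n) ↔ M a b)
    (h1 : ∀ a, M a (a+1))
    (hr : ∀ a b, 1 ≤ a → a < n → 1 ≤ b → b ≤ n → b ≠ a → b ≠ a + 1 →
      (M a b ↔ ¬ M (a+2) (b+1))) :
    Even n ∧ ∀ a b, 1 ≤ a → a < b → b ≤ n → (M a b ↔ Odd (b - a)) := by
  have hs : ∀ a b, M a b ↔ M b a := fun a b => ⟨hsymm a b, hsymm b a⟩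
  have hU : ∀ a b, 1 ≤ a → a + 1 < b → b < n → (M a b ↔ ¬ M (a+2) (b+1)) :=
    fun a b h1 h2 h3 => hr a b h1 (by omega) (by omega) (by omega) (by omega) (by omega)
  have hW1 : ∀ a, 1 ≤ a → a + 2 ≤ n → (M a n ↔ ¬ M 1 (a+2)) := by
    intro a ha hb
    rw [hr a n ha (by omega) (by omega) le_rfl (by omega) (by omega), add_comm n 1, hper, hs]
  have hW2 : ∀ a, 1 ≤ a → a + 2 ≤ n → (M a (n-1) ↔ ¬ M 1 (a+1)) := by
    intro a ha hb
    rw [hs, hr (n-1) a (by omega) (by omega) ha (by omega) (by omega) (by omega)]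
    have : n - 1 + 2 = 1 + n := by omega
    rw [this, hs, hper, hs]
  have f2 : M 1 2 := h1 1
  have fn : M 1 n := by
    rw [hs, ← hper, add_comm]; exact h1 n
  have f3step : ∀ k, 2 ≤ k → k + 3 ≤ n → (M 1 (k+3) ↔ ¬ M 1 k) := by
    intro k hk hkn
    have a1 := hW2 (k-1) (by omega) (by omega)
    have a2 := hU (k-1) (n-1) (by omega) (by omega) (by omega)
    have a3 := hW1 (k-1+2) (by omega) (by omega)
    have e1 : k - 1 + 2 + 2 = k + 3 := by omega
    have e2 : n - 1 + 1 = n := by omega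
    have e3 : k - 1 + 1 = k := by omega
    rw [e1] at a3
    rw [e2] at a2
    rw [e3] at a1
    tauto
  have f3 : 4 ≤ n → ¬ M 1 3 := by
    intro h
    have := hU 1 3 (by omega) (by omega) (by omega)
    have h3 := h1 3
    simp only [Nat.reduceAdd] at this h3
    tauto
  have hn3 : n ≠ 3 := by
    rintro rfl
    have := hW1 1 le_rfl (by omega)
    simp only [Nat.reduceAdd] at this
    tauto
  have hn5 : n ≠ 5 := by
    rintro rfl
    have := f3step 2 le_rfl (by omega)
    simp only [Nat.reduceAdd] at this
    tauto
  have f4 : 4 ≤ n → M 1 4 := by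
    intro h
    by_cases h4 : n = 4
    · subst h4; exact fn
    · have a1 := hU 1 4 (by omega) (by omega) (by omega)
      have a2 := hU 3 5 (by omega) (by omega) (by omega)
      have a3 := h1 5
      simp only [Nat.reduceAdd] at a1 a2 a3
      tauto
  have f : ∀ k, 2 ≤ k → k ≤ n → (M 1 k ↔ Even k) := by
    intro k
    induction k using Nat.strong_induction_on with
    | _ k ih =>
      intro hk hkn
      by_cases h5 : 5 ≤ k
      · obtain ⟨l, rfl⟩ : ∃ l, k = l + 3 := ⟨k-3, by omega⟩
        rw [f3step l (by omega) hkn, ih l (by omega) (by omega) (by omega)]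
        grind
      · have : k = 2 ∨ k = 3 ∨ k = 4 := by omega
        rcases this with rfl | rfl | rfl
        · simp [f2]
        · simp [f3 (by omega)]; decide
        · simp [f4 (by omega)]; decide
  have hev : Even n := (f n (by omega) le_rfl).1 fn
  refine ⟨hev, ?_⟩
  have main : ∀ d a b, b - a = d → 1 ≤ a → a < b → b ≤ n → (M a b ↔ Odd (b - a)) := by
    intro d
    induction d with
    | zero => intro a b h h1 h2; omega
    | succ d ih =>
      intro a b h ha hab hb
      by_cases hd : b = a + 1
      · subst hd; simp [h1]
      · by_cases hbn : b = n
        · subst hbn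
          rw [hW1 a ha (by omega), f (a+2) (by omega) (by omega)]
          grind
        · rw [hU a b ha (by omega) (by omega), ih (a+2) (b+1) (by omega) (by omega) (by omega)
            (by omega)]
          grind
  exact fun a b => main _ a b rfl

theorem stmt9 {V : Type*} [Fintype V] {n : ℕ} (hn : 3 ≤ n)
    (hV : Fintype.card V = n)
    (G : ZMod n → SimpleGraph V) [∀ i, DecidableRel (G i).Adj]
    (hσ : ∀ u v : V, u ≠ v → (∃ i, ¬ (G i).Adj u v) →
      ∀ p q, n ≤ (G p).degree u + (G q).degree v)
    (c : ZMod n → V) (hc : Function.Bijective c)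
    (hCn : ∀ i : ZMod n, (G i).Adj (c i) (c (i + 1)))
    (hno : ¬ HasRainbowCycleThrough G (n - 1) (c 1)) :
    Even n ∧
    (∀ (a i : ZMod n) (v : V), (G a).Adj (c i) v ↔
      ∃ j : ZMod n, c j = v ∧ ¬ (Even (ZMod.val i) ↔ Even (ZMod.val j))) ∧
    (∃ A : Finset V, 2 * A.card = n ∧
      ∀ (a : ZMod n) (u v : V), (G a).Adj u v ↔
        ((u ∈ A ∧ v ∉ A) ∨ (u ∉ A ∧ v ∈ A))) := by
  classical
  haveI : NeZero n := ⟨by omega⟩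
  haveI : Fact (1 < n) := ⟨by omega⟩
  have hcastinj : ∀ a b : ℕ, 1 ≤ a → a ≤ n → 1 ≤ b → b ≤ n → (a : ZMod n) = b → a = b := by
    intro a b ha ha' hb hb' h
    have h2 : ((a - 1 : ℕ) : ZMod n) = ((b - 1 : ℕ) : ZMod n) := by
      rw [Nat.cast_sub ha, Nat.cast_sub hb, h]
    have := (ZMod.natCast_eq_natCast_iff' _ _ n).1 h2
    rw [Nat.mod_eq_of_lt (by omega), Nat.mod_eq_of_lt (by omega)] at this
    omega
  have hcrep : ∀ j : ZMod n, ∃ k : ℕ, 1 ≤ k ∧ k ≤ n ∧ j = k ∧ (k = j.val ∨ (k = n ∧ j.val = 0)) := by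
    intro j
    have := ZMod.val_lt j
    by_cases h : j.val = 0
    · exact ⟨n, by omega, le_rfl, by simpa using h, Or.inr ⟨rfl, h⟩⟩
    · exact ⟨j.val, by omega, by omega, by simp, Or.inl rfl⟩
  have hsub1 : ∀ i : ZMod n, i - 1 ≠ i := by
    intro i h
    have : (1 : ZMod n) = 0 := by simpa using h
    exact one_ne_zero this
  have hall : ∀ a k : ZMod n, (G a).Adj (c k) (c (k+1)) := by
    intro a
    let S : ZMod n → Prop := fun k => ∃ φ : Equiv.Perm (ZMod n),
      (∀ i, (G (φ i)).Adj (c i) (c (i+1))) ∧ φ k = a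
    have hswap : ∀ (φ : Equiv.Perm (ZMod n)) (i : ZMod n), i ≠ 1 →
        (∀ i, (G (φ i)).Adj (c i) (c (i+1))) →
        ∀ j, (G ((Equiv.swap (i-1) i * φ.symm).symm j)).Adj (c j) (c (j+1)) := by
      intro φ i hi hφ j
      have := cyc_core hn G hσ c hc hno i hi φ φ.injective (fun k _ _ => hφ k)
      have e : (Equiv.swap (i-1) i * φ.symm).symm j = φ (Equiv.swap (i-1) i j) := by
        rw [Equiv.symm_apply_eq]
        simp
      rw [e]
      by_cases h1 : j = i
      · subst h1; simpa using this.1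
      · by_cases h2 : j = i - 1
        · subst h2; simpa using this.2.1
        · rw [Equiv.swap_apply_of_ne_of_ne h2 h1]; exact hφ j
    have hS : ∀ i : ZMod n, i ≠ 1 → (S (i-1) ↔ S i) := by
      intro i hi
      constructor
      · rintro ⟨φ, h, h'⟩
        refine ⟨_, hswap φ i hi h, ?_⟩
        rw [← h', Equiv.symm_apply_eq]; simp
      · rintro ⟨φ, h, h'⟩
        refine ⟨_, hswap φ i hi h, ?_⟩
        rw [← h', Equiv.symm_apply_eq]; simp
    have hS1 : ∀ k : ℕ, 1 ≤ k → k ≤ n → (S 1 ↔ S k) := by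
      intro k hk
      induction k, hk using Nat.le_induction with
      | base => intro _; simp
      | succ k hk ih =>
        intro hkn
        rw [ih (by omega), ← hS ((k+1 : ℕ) : ZMod n)]
        · simp
        · intro h
          have := hcastinj (k+1) 1 (by omega) (by omega) (by omega) (by omega) (by simpa using h)
          omega
    have hSall : ∀ k, S k := by
      intro k
      obtain ⟨k', h1, h2, rfl, -⟩ := hcrep k
      rw [← hS1 k' h1 h2]
      obtain ⟨a', h1, h2, h3, -⟩ := hcrep a
      rw [hS1 a' h1 h2, ← h3]
      exact ⟨1, hCn, rfl⟩
    intro k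
    obtain ⟨φ, h, h'⟩ := hSall k
    rw [← h']; exact h k
  have halt : ∀ i : ZMod n, i ≠ 1 → ∀ p q, p ≠ q → ∀ j, j ≠ i - 1 → j ≠ i →
      ((G p).Adj (c (i+1)) (c (j+1)) ↔ ¬ (G q).Adj (c (i-1)) (c j)) := by
    intro i hi p q hpq j hj1 hj2
    obtain ⟨φ, hφ1, hφ2⟩ : ∃ φ : Equiv.Perm (ZMod n), φ (i-1) = p ∧ φ i = q := by
      refine ⟨Equiv.swap (Equiv.swap (i-1) p i) q * Equiv.swap (i-1) p, ?_, ?_⟩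
      · rw [Equiv.Perm.mul_apply, Equiv.swap_apply_left, Equiv.swap_apply_of_ne_of_ne]
        · intro h
          have : Equiv.swap (i-1) p (i-1) = Equiv.swap (i-1) p i := by
            rw [Equiv.swap_apply_left]; exact h
          exact hsub1 i ((Equiv.swap (i-1) p).injective this)
        · exact hpq
      · rw [Equiv.Perm.mul_apply, Equiv.swap_apply_left]
    have := (cyc_core hn G hσ c hc hno i hi φ φ.injective (fun k _ _ => hall _ _)).2.2 j hj1 hj2
    rwa [hφ1, hφ2] at this
  have hthird : ∀ p q : ZMod n, ∃ r, r ≠ p ∧ r ≠ q := by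
    intro p q
    have : ∃ r, r ∉ ({p, q} : Finset (ZMod n)) := by
      by_contra h
      push Not at h
      have h2 : (Finset.univ : Finset (ZMod n)) ⊆ {p, q} := fun x _ => h x
      have := Finset.card_le_card h2
      have h3 : ({p, q} : Finset (ZMod n)).card ≤ 2 := Finset.card_le_two
      rw [Finset.card_univ, ZMod.card] at this
      omega
    obtain ⟨r, hr⟩ := this
    simp at hr
    exact ⟨r, hr.1, hr.2⟩
  have hcol0 : ∀ (p q k j : ZMod n), k ≠ 0 → (G p).Adj (c k) (c j) → (G q).Adj (c k) (c j) := by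
    intro p q k j hk h
    obtain ⟨r, hr1, hr2⟩ := hthird p q
    by_cases h1 : j = k
    · subst h1; exact absurd h (SimpleGraph.irrefl _)
    by_cases h2 : j = k + 1
    · subst h2; exact hall _ _
    have hi : k + 1 ≠ 1 := by simpa using hk
    have a1 := halt (k+1) hi r p hr1 j (by simpa using h1) h2
    have a2 := halt (k+1) hi r q hr2 j (by simpa using h1) h2
    rw [add_sub_cancel_right] at a1 a2
    tauto
  have hcol : ∀ (p q k j : ZMod n), (G p).Adj (c k) (c j) → (G q).Adj (c k) (c j) := by
    intro p q k j h
    by_cases hk : k = 0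
    · by_cases hj : j = 0
      · subst hk; subst hj; exact absurd h (SimpleGraph.irrefl _)
      · exact (hcol0 p q j k hj h.symm).symm
    · exact hcol0 p q k j hk h
  have hcomb := comb hn (fun a b => (G 0).Adj (c (a : ZMod n)) (c (b : ZMod n)))
    (fun a b h => h.symm) (fun a b => by simp) (fun a => by simpa using hall 0 (a : ZMod n))
    (by
      intro a b ha han hb hbn h1 h2
      have hi : ((a : ZMod n) + 1) ≠ 1 := by
        intro h
        have : (a : ZMod n) = (n : ℕ) := by simpa using h
        have := hcastinj _ _ ha han.le (by omega) le_rfl this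
        omega
      have := halt ((a : ZMod n) + 1) hi 1 0 one_ne_zero (b : ZMod n) (by
        rw [add_sub_cancel_right]
        intro h
        exact h1 (hcastinj _ _ hb hbn ha han.le h)) (by
        intro h
        exact h2 (hcastinj _ _ hb hbn (by omega) (by omega) (by simpa using h)))
      rw [add_sub_cancel_right] at this
      have e1 : ((a + 2 : ℕ) : ZMod n) = (a : ZMod n) + 1 + 1 := by push_cast; ring
      have e2 : ((b + 1 : ℕ) : ZMod n) = (b : ZMod n) + 1 := by push_cast; ring
      simp only [e1, e2]
      have h10 : (G 0).Adj (c ((a : ZMod n) + 1 + 1)) (c ((b : ZMod n) + 1)) ↔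
        (G 1).Adj (c ((a : ZMod n) + 1 + 1)) (c ((b : ZMod n) + 1)) := ⟨hcol _ _ _ _, hcol _ _ _ _⟩
      tauto)
  obtain ⟨hev, hpar⟩ := hcomb
  have hfin : ∀ a i j : ZMod n, (G a).Adj (c i) (c j) ↔ ¬ (Even i.val ↔ Even j.val) := by
    intro a i j
    have h0 : (G a).Adj (c i) (c j) ↔ (G 0).Adj (c i) (c j) := ⟨hcol _ _ _ _, hcol _ _ _ _⟩
    rw [h0]
    obtain ⟨k, hk1, hk2, hk3, hk4⟩ := hcrep i
    obtain ⟨l, hl1, hl2, hl3, hl4⟩ := hcrep j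
    have ek : Even i.val ↔ Even k := by
      rcases hk4 with h | ⟨h, h'⟩
      · rw [h]
      · rw [h, h']; simp [hev]
    have el : Even j.val ↔ Even l := by
      rcases hl4 with h | ⟨h, h'⟩
      · rw [h]
      · rw [h, h']; simp [hev]
    rw [ek, el, hk3, hl3]
    rcases lt_trichotomy k l with h | h | h
    · rw [hpar k l hk1 h hl2]; grind
    · subst h; simp
    · rw [SimpleGraph.adj_comm, hpar l k hl1 h hk2]; grind
  refine ⟨hev, ?_, ?_⟩
  · intro a i v
    obtain ⟨j, rfl⟩ := hc.2 v
    rw [hfin]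
    constructor
    · intro h; exact ⟨j, rfl, h⟩
    · rintro ⟨j', h, h'⟩
      rw [← hc.1 h]; exact h'
  · refine ⟨(Finset.range (n/2)).image (fun k => c ((2*k : ℕ) : ZMod n)), ?_, ?_⟩
    · rw [Finset.card_image_of_injOn, Finset.card_range]
      · obtain ⟨k, hk⟩ := hev; omega
      · intro a ha b hb h
        simp only [Finset.coe_range, Set.mem_Iio] at ha hb
        have := (ZMod.natCast_eq_natCast_iff' _ _ n).1 (hc.1 h)
        rw [Nat.mod_eq_of_lt (by omega), Nat.mod_eq_of_lt (by omega)] at this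
        omega
    · have hmem : ∀ j, c j ∈ (Finset.range (n/2)).image (fun k => c ((2*k : ℕ) : ZMod n)) ↔
          Even j.val := by
        intro j
        rw [Finset.mem_image]
        constructor
        · rintro ⟨k, hk, h⟩
          rw [Finset.mem_range] at hk
          rw [← hc.1 h, ZMod.val_natCast, Nat.mod_eq_of_lt (by omega)]
          simp
        · rintro ⟨k, hk⟩
          have := ZMod.val_lt j
          refine ⟨k, ?_, ?_⟩
          · rw [Finset.mem_range]
            obtain ⟨r, hr⟩ := hev
            omega
          · show c _ = c j
            rw [two_mul, ← hk, ZMod.natCast_zmod_val]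
      intro a u v
      obtain ⟨i, rfl⟩ := hc.2 u
      obtain ⟨j, rfl⟩ := hc.2 v
      rw [hfin, hmem, hmem]
      tauto
end

section
/- Let n ≥ 8 and let 𝒢 = {G_1, …, G_n} be a family of n graphs (not necessarily distinct) on a common vertex set V with |V| = n. If σ(𝒢) ≥ n, then every vertex of V is contained in a rainbow cycle of length n − 2 in 𝒢. -/
namespace RB

variable {V ι : Type*}

/-- Rainbow path on `m` vertices. -/
structure RP (G : ι → SimpleGraph V) (m : ℕ) (p : ℕ → V) (f : ℕ → ι) : Prop where
  vinj : ∀ i j, i < m → j < m → p i = p j → i = j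
  cinj : ∀ i j, i + 1 < m → j + 1 < m → f i = f j → i = j
  adj : ∀ i, i + 1 < m → (G (f i)).Adj (p i) (p (i + 1))

/-- Rainbow cycle on `m` vertices, as periodic functions. -/
structure RC (G : ι → SimpleGraph V) (m : ℕ) (p : ℕ → V) (f : ℕ → ι) : Prop where
  vinj : ∀ i j, p i = p j → i % m = j % m
  cinj : ∀ i j, f i = f j → i % m = j % m
  vper : ∀ i, p (i + m) = p i
  cper : ∀ i, f (i + m) = f i
  adj : ∀ i, (G (f i)).Adj (p i) (p (i + 1))

/-- Colour not used on a path. -/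
def Sp (m : ℕ) (f : ℕ → ι) (a : ι) : Prop := ∀ i, i + 1 < m → f i ≠ a

/-- Vertex off the path. -/
def Off (m : ℕ) (p : ℕ → V) (y : V) : Prop := ∀ i, i < m → p i ≠ y

variable {G : ι → SimpleGraph V}

lemma mk_cycle {m : ℕ} {p : ℕ → V} {f : ℕ → ι} (h : RP G m p f) (hm : 1 ≤ m) {a : ι}
    (ha : Sp m f a) (e : (G a).Adj (p (m - 1)) (p 0)) :
    ∃ c g, RC G m c g ∧ ∀ i, i < m → c i = p i := by
  have hlt : ∀ i, i % m < m := fun i => Nat.mod_lt _ (by omega)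
  refine ⟨fun i => p (i % m), fun i => if i % m + 1 = m then a else f (i % m),
    ⟨?_, ?_, ?_, ?_, ?_⟩, ?_⟩
  · intro i j hij
    exact h.vinj _ _ (hlt i) (hlt j) hij
  · intro i j hij
    have h1 := hlt i
    have h2 := hlt j
    try simp only at hij
    split_ifs at hij with h3 h4 h4
    · omega
    · exact absurd hij.symm (ha _ (by omega))
    · exact absurd hij (ha _ (by omega))
    · exact h.cinj _ _ (by omega) (by omega) hij
  · intro i; simp
  · intro i; simp
  · intro i
    have h1 := hlt i
    have h5 : (i + 1) % m = (i % m + 1) % m := by simp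
    try simp only
    split_ifs with h3
    · rw [h5, h3, Nat.mod_self]
      have : i % m = m - 1 := by omega
      rw [this]; exact e
    · rw [h5, Nat.mod_eq_of_lt (by omega : i % m + 1 < m)]
      exact h.adj _ (by omega)
  · intro i hi
    simp [Nat.mod_eq_of_lt hi]

lemma mod_cancel {m k i j : ℕ} (hi : i < m) (hj : j < m) (h : (k + i) % m = (k + j) % m) :
    i = j := by
  have h1 : k + i ≡ k + j [MOD m] := h
  have h2 := Nat.ModEq.add_left_cancel' k h1
  exact Nat.ModEq.eq_of_lt_of_lt h2 hi hj

lemma RC.window {m : ℕ} {c : ℕ → V} {g : ℕ → ι} (h : RC G m c g) (k l : ℕ) (hl : l ≤ m) :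
    RP G l (fun i => c (k + i)) (fun i => g (k + i)) := by
  refine ⟨?_, ?_, ?_⟩
  · intro i j hi hj e
    exact mod_cancel (by omega) (by omega) (h.vinj _ _ e)
  · intro i j hi hj e
    exact mod_cancel (by omega) (by omega) (h.cinj _ _ e)
  · intro i _
    exact h.adj (k + i)

lemma RC.rot {m : ℕ} {c : ℕ → V} {g : ℕ → ι} (h : RC G m c g) (k : ℕ) :
    RC G m (fun i => c (k + i)) (fun i => g (k + i)) := by
  refine ⟨?_, ?_, ?_, ?_, ?_⟩
  · intro i j e
    exact Nat.ModEq.add_left_cancel' k (h.vinj _ _ e)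
  · intro i j e
    exact Nat.ModEq.add_left_cancel' k (h.cinj _ _ e)
  · intro i; simpa [add_assoc] using h.vper (k + i)
  · intro i; simpa [add_assoc] using h.cper (k + i)
  · intro i; exact h.adj (k + i)

lemma snoc {m : ℕ} {p : ℕ → V} {f : ℕ → ι} (h : RP G m p f) (hm : 1 ≤ m) {a : ι}
    (ha : Sp m f a) {y : V} (hy : Off m p y) (e : (G a).Adj (p (m - 1)) y) :
    RP G (m + 1) (fun i => if i < m then p i else y) (fun i => if i + 1 < m then f i else a) := by
  refine ⟨?_, ?_, ?_⟩
  · intro i j hi hj hij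
    try simp only at hij
    split_ifs at hij with h1 h2 h2
    · exact h.vinj _ _ h1 h2 hij
    · exact absurd hij (hy _ h1)
    · exact absurd hij.symm (hy _ h2)
    · omega
  · intro i j hi hj hij
    try simp only at hij
    split_ifs at hij with h1 h2 h2
    · exact h.cinj _ _ h1 h2 hij
    · exact absurd hij (ha _ h1)
    · exact absurd hij.symm (ha _ h2)
    · omega
  · intro i hi
    by_cases h1 : i + 1 < m
    · simp only [h1, if_true, show i < m by omega]
      exact h.adj _ h1
    · have : i = m - 1 := by omega
      subst this
      simp only [h1, if_false, show m - 1 < m by omega, if_true]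
      exact e

lemma rev {m : ℕ} {p : ℕ → V} {f : ℕ → ι} (h : RP G m p f) :
    RP G m (fun i => p (m - 1 - i)) (fun i => f (m - 2 - i)) := by
  refine ⟨?_, ?_, ?_⟩
  · intro i j hi hj hij
    have := h.vinj _ _ (by omega) (by omega) hij
    omega
  · intro i j hi hj hij
    have := h.cinj _ _ (by omega) (by omega) hij
    omega
  · intro i hi
    have := h.adj (m - 2 - i) (by omega)
    rw [show m - 2 - i + 1 = m - 1 - i by omega] at this
    rw [show m - 1 - (i + 1) = m - 2 - i by omega]
    exact this.symm

lemma close {m : ℕ} {p : ℕ → V} {f : ℕ → ι} (h : RP G m p f) (hm : 1 ≤ m) {a b : ι}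
    (hab : a ≠ b) (ha : Sp m f a) (hb : Sp m f b) {y : V} (hy : Off m p y)
    (e : (G a).Adj (p 0) y) (e' : (G b).Adj (p (m - 1)) y) :
    ∃ c g, RC G (m + 1) c g ∧ ∀ i, i < m → c i = p i := by
  have h1 := snoc h hm hb hy e'
  obtain ⟨c, g, h2, h3⟩ := mk_cycle (a := a) h1 (by omega)
    (by
      intro i hi
      try simp only
      split_ifs with h4
      · exact ha _ h4
      · exact hab.symm)
    (by
      simp only [show ¬ (m + 1 - 1 < m) by omega, if_false, show 0 < m by omega, if_true]
      exact e.symm)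
  refine ⟨c, g, h2, fun i hi => ?_⟩
  rw [h3 i (by omega)]; simp [hi]

lemma cross {m : ℕ} {p : ℕ → V} {f : ℕ → ι} (h : RP G m p f) {a b : ι}
    (hab : a ≠ b) (ha : Sp m f a) (hb : Sp m f b) {i : ℕ} (hi : i + 1 < m)
    (e : (G a).Adj (p 0) (p (i + 1))) (e' : (G b).Adj (p (m - 1)) (p i)) :
    ∃ c g, RC G m c g ∧ ∀ i, i < m → ∃ j, c j = p i := by
  have h1 : RP G m (fun j => if j ≤ i then p j else p (m + i - j))
      (fun j => if j < i then f j else if j = i then b else f (m + i - j - 1)) := by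
    refine ⟨?_, ?_, ?_⟩
    · intro j k hj hk hjk
      try simp only at hjk
      split_ifs at hjk
      all_goals
        have := h.vinj _ _ (by omega) (by omega) hjk
        omega
    · intro j k hj hk hjk
      try simp only at hjk
      split_ifs at hjk
      any_goals omega
      all_goals first
        | exact absurd hjk (hb _ (by omega))
        | exact absurd hjk.symm (hb _ (by omega))
        | skip
      all_goals
        have := h.cinj _ _ (by omega) (by omega) hjk
        omega
    · intro j hj
      rcases lt_trichotomy j i with hl | hl | hl
      · simp only [hl, if_true, show j ≤ i by omega, show j + 1 ≤ i by omega]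
        exact h.adj _ (by omega)
      · subst hl
        simp only [lt_irrefl, if_false, if_true, le_refl, show ¬ (j + 1 ≤ j) by omega]
        rw [show m + j - (j + 1) = m - 1 by omega]
        exact e'.symm
      · simp only [show ¬ (j < i) by omega, show ¬ (j = i) by omega, show ¬ (j ≤ i) by omega,
          show ¬ (j + 1 ≤ i) by omega, if_false]
        have := h.adj (m + i - j - 1) (by omega)
        rw [show m + i - j - 1 + 1 = m + i - j by omega] at this
        rw [show m + i - (j + 1) = m + i - j - 1 by omega]
        exact this.symm
  obtain ⟨c, g, h2, h3⟩ := mk_cycle (a := a) h1 (by omega)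
    (by
      intro j hj
      try simp only
      split_ifs
      · exact ha _ (by omega)
      · exact hab.symm
      · exact ha _ (by omega))
    (by
      simp only [show ¬ (m - 1 ≤ i) by omega, if_false, Nat.zero_le, if_true]
      rw [show m + i - (m - 1) = i + 1 by omega]
      exact e.symm)
  refine ⟨c, g, h2, fun j hj => ?_⟩
  by_cases hji : j ≤ i
  · exact ⟨j, by rw [h3 j hj]; simp [hji]⟩
  · refine ⟨m + i - j, ?_⟩
    rw [h3 _ (by omega)]
    simp only [show ¬ (m + i - j ≤ i) by omega, if_false]
    rw [show m + i - (m + i - j) = j by omega]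

lemma skip {m : ℕ} {p : ℕ → V} {f : ℕ → ι} (h : RP G m p f) {s : ℕ} (hs : 1 ≤ s)
    (hs' : s + 1 < m) (e : (G (f (s - 1))).Adj (p (s - 1)) (p (s + 1))) :
    RP G (m - 1) (fun j => if j < s then p j else p (j + 1))
      (fun j => if j < s then f j else f (j + 1)) := by
  refine ⟨?_, ?_, ?_⟩
  · intro j k hj hk hjk
    try simp only at hjk
    split_ifs at hjk
    all_goals
      have := h.vinj _ _ (by omega) (by omega) hjk
      omega
  · intro j k hj hk hjk
    try simp only at hjk
    split_ifs at hjk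
    all_goals
      have := h.cinj _ _ (by omega) (by omega) hjk
      omega
  · intro j hj
    rcases lt_trichotomy (j + 1) s with hl | hl | hl
    · simp only [hl, if_true, show j < s by omega]
      exact h.adj _ (by omega)
    · subst hl
      simp only [lt_irrefl, if_false, show j < j + 1 by omega, if_true]
      exact e
    · simp only [show ¬ (j < s) by omega, show ¬ (j + 1 < s) by omega, if_false]
      exact h.adj _ (by omega)

section count

variable [Fintype V]

open Classical in
/-- neighbours -/
noncomputable def N (G : SimpleGraph V) (v : V) : Finset V := Finset.univ.filter (G.Adj v)

/-- Ore-type condition -/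
def Ore (G : ι → SimpleGraph V) : Prop := ∀ u v : V, u ≠ v → (∃ i, ¬ (G i).Adj u v) →
      ∀ p q, Fintype.card V ≤ (N (G p) u).card + (N (G q) v).card

open Classical in
/-- neighbours off the path -/
noncomputable def NO (G : SimpleGraph V) (m : ℕ) (p : ℕ → V) (v : V) : Finset V :=
  (N G v).filter (Off m p)

open Classical in
lemma off_card {m : ℕ} {p : ℕ → V} {f : ℕ → ι} (h : RP G m p f) :
    (Finset.univ.filter (Off m p)).card + m = Fintype.card V := by
  have h1 : (Finset.univ.filter (Off m p)) = ((Finset.range m).image p)ᶜ := by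
    ext w; simp [Off]
  have h2 : ((Finset.range m).image p).card = m := by
    rw [Finset.card_image_of_injOn, Finset.card_range]
    intro i hi j hj hij
    exact h.vinj _ _ (by simpa using hi) (by simpa using hj) hij
  have h3 := Finset.card_add_card_compl ((Finset.range m).image p)
  rw [h1]; omega

lemma mindeg (hO : Ore G) (h3 : 3 ≤ Fintype.card V) (a : ι) (v : V) : 2 ≤ (N (G a) v).card := by
  classical
  by_contra hc
  have : ∃ w, w ∉ insert v (N (G a) v) := by
    by_contra hw
    push Not at hw
    have h1 : (insert v (N (G a) v)) = Finset.univ := Finset.eq_univ_iff_forall.2 hw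
    have h2 := Finset.card_insert_le v (N (G a) v)
    rw [h1, Finset.card_univ] at h2
    omega
  obtain ⟨w, hw⟩ := this
  simp only [Finset.mem_insert, not_or] at hw
  have hna : ¬ (G a).Adj v w := by simpa [N] using hw.2
  have h1 := hO v w (Ne.symm hw.1) ⟨a, hna⟩ a a
  have h2 : N (G a) w ⊆ ({v, w} : Finset V)ᶜ := by
    intro z hz
    have hz' : (G a).Adj w z := by simpa [N] using hz
    simp only [Finset.mem_compl, Finset.mem_insert, Finset.mem_singleton, not_or]
    exact ⟨fun h => hna (h ▸ hz'.symm), fun h => hz'.ne h.symm⟩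
  have h4 := Finset.card_le_card h2
  have h5 := Finset.card_add_card_compl ({v, w} : Finset V)
  rw [Finset.card_pair (Ne.symm hw.1)] at h5
  omega

lemma key (hO : Ore G) {m : ℕ} {p : ℕ → V} {f : ℕ → ι} (h : RP G m p f) (hm : 2 ≤ m) {a b : ι}
    (hab : a ≠ b) (ha : Sp m f a) (hb : Sp m f b) :
    (∃ c g, RC G m c g ∧ ∀ i, i < m → ∃ j, c j = p i) ∨
    Fintype.card V + 1 ≤ m + (NO (G a) m p (p 0)).card + (NO (G b) m p (p (m - 1))).card := by
  classical
  by_cases e0 : (G a).Adj (p (m - 1)) (p 0)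
  · left
    obtain ⟨c, g, h1, h2⟩ := mk_cycle h (by omega) ha e0
    exact ⟨c, g, h1, fun i hi => ⟨i, h2 i hi⟩⟩
  by_cases hcr : ∃ i, i + 1 < m ∧ (G a).Adj (p 0) (p (i + 1)) ∧ (G b).Adj (p (m - 1)) (p i)
  · obtain ⟨i, hi, e, e'⟩ := hcr
    exact Or.inl (cross h hab ha hb hi e e')
  right
  have hne : p 0 ≠ p (m - 1) := fun h0 => by
    have := h.vinj _ _ (by omega) (by omega) h0
    omega
  have hd := hO (p 0) (p (m - 1)) hne ⟨a, fun e => e0 e.symm⟩ a b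
  set A := (Finset.range (m - 1)).filter (fun i => (G a).Adj (p 0) (p (i + 1))) with hA
  set B := (Finset.range (m - 1)).filter (fun i => (G b).Adj (p (m - 1)) (p i)) with hB
  have hdis : Disjoint A B := by
    rw [Finset.disjoint_left]
    intro i hi hi'
    simp only [hA, hB, Finset.mem_filter, Finset.mem_range] at hi hi'
    exact hcr ⟨i, by omega, hi.2, hi'.2⟩
  have h1 : A.card + B.card ≤ m - 1 := by
    rw [← Finset.card_union_of_disjoint hdis]
    calc _ ≤ (Finset.range (m - 1)).card := Finset.card_le_card
            (Finset.union_subset (Finset.filter_subset _ _) (Finset.filter_subset _ _))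
      _ = _ := Finset.card_range _
  have h2 : (N (G a) (p 0)).card ≤ A.card + (NO (G a) m p (p 0)).card := by
    have : N (G a) (p 0) ⊆ A.image (fun i => p (i + 1)) ∪ NO (G a) m p (p 0) := by
      intro w hw
      by_cases ho : Off m p w
      · exact Finset.mem_union_right _ (Finset.mem_filter.2 ⟨hw, ho⟩)
      · apply Finset.mem_union_left
        simp only [Off, not_forall, not_not] at ho
        obtain ⟨i, hi, rfl⟩ := ho
        have hw' : (G a).Adj (p 0) (p i) := by simpa [N] using hw
        have hi0 : i ≠ 0 := by rintro rfl; exact hw'.ne rfl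
        refine Finset.mem_image.2 ⟨i - 1, ?_, ?_⟩
        · simp only [hA, Finset.mem_filter, Finset.mem_range]
          rw [show i - 1 + 1 = i by omega]
          exact ⟨by omega, hw'⟩
        · simp only [show i - 1 + 1 = i by omega]
    calc _ ≤ _ := Finset.card_le_card this
      _ ≤ _ := Finset.card_union_le _ _
      _ ≤ _ := Nat.add_le_add_right Finset.card_image_le _
  have h3 : (N (G b) (p (m - 1))).card ≤ B.card + (NO (G b) m p (p (m - 1))).card := by
    have : N (G b) (p (m - 1)) ⊆ B.image p ∪ NO (G b) m p (p (m - 1)) := by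
      intro w hw
      by_cases ho : Off m p w
      · exact Finset.mem_union_right _ (Finset.mem_filter.2 ⟨hw, ho⟩)
      · apply Finset.mem_union_left
        simp only [Off, not_forall, not_not] at ho
        obtain ⟨i, hi, rfl⟩ := ho
        have hw' : (G b).Adj (p (m - 1)) (p i) := by simpa [N] using hw
        have hi0 : i ≠ m - 1 := by rintro rfl; exact hw'.ne rfl
        refine Finset.mem_image.2 ⟨i, ?_, rfl⟩
        simp only [hB, Finset.mem_filter, Finset.mem_range]
        exact ⟨by omega, hw'⟩
    calc _ ≤ _ := Finset.card_le_card this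
      _ ≤ _ := Finset.card_union_le _ _
      _ ≤ _ := Nat.add_le_add_right Finset.card_image_le _
  omega

lemma NO_le {m : ℕ} {p : ℕ → V} {f : ℕ → ι} (h : RP G m p f) (a : ι) (v : V) :
    (NO (G a) m p v).card + m ≤ Fintype.card V := by
  classical
  rw [← off_card h]
  exact Nat.add_le_add_right (Finset.card_le_card
    (Finset.filter_subset_filter _ (Finset.subset_univ _))) _

lemma NO_lt {m : ℕ} {p : ℕ → V} {f : ℕ → ι} (h : RP G m p f) (a : ι) (v : V) {y : V}
    (hy : Off m p y) (hn : ¬ (G a).Adj v y) :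
    (NO (G a) m p v).card + m + 1 ≤ Fintype.card V := by
  classical
  rw [← off_card h]
  have : NO (G a) m p v ⊂ Finset.univ.filter (Off m p) := by
    refine Finset.ssubset_iff_of_subset
      (Finset.filter_subset_filter _ (Finset.subset_univ _)) |>.2 ⟨y, by simpa using hy, ?_⟩
    simp [NO, N, hn]
  have := Finset.card_lt_card this
  omega

/-- Every vertex is on a rainbow cycle with `m` vertices (predicate). -/
def Thru (G : ι → SimpleGraph V) (m : ℕ) (x : V) : Prop := ∃ c g, RC G m c g ∧ c 0 = x

lemma RC.thru {m : ℕ} {c : ℕ → V} {g : ℕ → ι} (h : RC G m c g) (k : ℕ) : Thru G m (c k) :=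
  ⟨_, _, h.rot k, rfl⟩

/-- Path on `n-2` vertices. -/
lemma two_off (hO : Ore G) {m : ℕ} {p : ℕ → V} {f : ℕ → ι} (h : RP G m p f) (hm : 2 ≤ m)
    (hmn : m + 2 = Fintype.card V) {a b : ι}
    (hab : a ≠ b) (ha : Sp m f a) (hb : Sp m f b) {x : V} (hx : ∃ i, i < m ∧ p i = x)
    (hno : ¬ Thru G m x) {y z : V} (hy : Off m p y) (hz : Off m p z) :
    (G a).Adj (p 0) y ∨ (G b).Adj (p (m - 1)) z := by
  by_contra hc
  push Not at hc
  rcases key hO h hm hab ha hb with ⟨c, g, h1, h2⟩ | h1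
  · obtain ⟨i, hi, rfl⟩ := hx
    obtain ⟨j, hj⟩ := h2 i hi
    exact hno (hj ▸ h1.thru j)
  · have h3 := NO_lt h a _ hy hc.1
    have h4 := NO_lt h b _ hz hc.2
    omega

variable [Fintype ι]

lemma spare2 {m : ℕ} {f : ℕ → ι} (hm : 1 ≤ m) (hc : m + 1 ≤ Fintype.card ι) :
    ∃ a b, a ≠ b ∧ Sp m f a ∧ Sp m f b := by
  classical
  have h1 : ((Finset.range (m - 1)).image f).card ≤ m - 1 :=
    Finset.card_image_le.trans (Finset.card_range _).le
  have h2 := Finset.card_add_card_compl ((Finset.range (m - 1)).image f)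
  have h3 : 1 < (((Finset.range (m - 1)).image f)ᶜ).card := by omega
  obtain ⟨a, ha, b, hb, hab⟩ := Finset.one_lt_card.1 h3
  simp only [Finset.mem_compl, Finset.mem_image, Finset.mem_range, not_exists, not_and] at ha hb
  exact ⟨a, b, hab, fun i hi => ha i (by omega), fun i hi => hb i (by omega)⟩

lemma RC.spare {m : ℕ} {c : ℕ → V} {g : ℕ → ι} (h : RC G m c g) (hm : 1 ≤ m)
    (hc : m < Fintype.card ι) : ∃ a, ∀ i, g i ≠ a := by
  classical
  have h1 : ((Finset.range m).image g).card ≤ m :=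
    Finset.card_image_le.trans (Finset.card_range _).le
  have : ∃ a, a ∉ (Finset.range m).image g := by
    by_contra hw
    push Not at hw
    have h2 := Finset.eq_univ_iff_forall.2 hw
    rw [h2, Finset.card_univ] at h1
    omega
  obtain ⟨a, ha⟩ := this
  refine ⟨a, fun i hi => ha (Finset.mem_image.2 ⟨i % m, ?_, ?_⟩)⟩
  · exact Finset.mem_range.2 (Nat.mod_lt _ (by omega))
  · rw [← hi]
    exact (Function.Periodic.map_mod_nat h.cper i)

lemma RC.off {m : ℕ} {c : ℕ → V} {g : ℕ → ι} (h : RC G m c g) (hm : 1 ≤ m)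
    (hc : m < Fintype.card V) : ∃ y, ∀ i, c i ≠ y := by
  classical
  have h1 : ((Finset.range m).image c).card ≤ m :=
    Finset.card_image_le.trans (Finset.card_range _).le
  have : ∃ a, a ∉ (Finset.range m).image c := by
    by_contra hw
    push Not at hw
    have h2 := Finset.eq_univ_iff_forall.2 hw
    rw [h2, Finset.card_univ] at h1
    omega
  obtain ⟨a, ha⟩ := this
  refine ⟨a, fun i hi => ha (Finset.mem_image.2 ⟨i % m, ?_, ?_⟩)⟩
  · exact Finset.mem_range.2 (Nat.mod_lt _ (by omega))
  · rw [← hi]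
    exact (Function.Periodic.map_mod_nat h.vper i)

/-- A cycle which is not spanning has an outgoing edge in every colour. -/
lemma out_edge (hO : Ore G) {m : ℕ} {c : ℕ → V} {g : ℕ → ι} (h : RC G m c g) (hm : 1 ≤ m)
    (hc : m < Fintype.card V) (a : ι) : ∃ j y, (∀ i, c i ≠ y) ∧ (G a).Adj (c j) y := by
  classical
  by_contra hno
  push Not at hno
  obtain ⟨y, hy⟩ := h.off hm hc
  have hd := hO (c 0) y (hy 0) ⟨a, hno 0 y hy⟩ a a
  have h1 : N (G a) (c 0) ⊆ Finset.univ.filter (fun w => ∃ i, c i = w) := by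
    intro w hw
    have hw' : (G a).Adj (c 0) w := by simpa [N] using hw
    by_contra hc
    simp only [Finset.mem_filter, Finset.mem_univ, true_and, not_exists] at hc
    exact hno 0 w hc hw'
  have h2 : N (G a) y ⊆ (Finset.univ.filter (fun w => ∃ i, c i = w))ᶜ := by
    intro w hw
    have hw' : (G a).Adj y w := by simpa [N] using hw
    simp only [Finset.mem_compl, Finset.mem_filter, Finset.mem_univ, true_and]
    rintro ⟨i, rfl⟩
    exact hno i y hy hw'.symm
  have h1' : N (G a) (c 0) ⊂ Finset.univ.filter (fun w => ∃ i, c i = w) := by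
    refine (Finset.ssubset_iff_of_subset h1).2 ⟨c 0, by simp, by simp [N]⟩
  have h3 := Finset.card_lt_card h1'
  have h4 := Finset.card_le_card h2
  have h5 := Finset.card_add_card_compl (Finset.univ.filter (fun w => ∃ i, c i = w))
  omega

lemma grow (hO : Ore G) (hcard : Fintype.card ι = Fintype.card V) (h3 : 3 ≤ Fintype.card V)
    (x : V) (m : ℕ) (hm : 2 ≤ m) (hmn : m + 1 ≤ Fintype.card V) :
    ∃ p f, RP G m p f ∧ ∃ i, i < m ∧ p i = x := by
  induction m, hm using Nat.le_induction with
  | base =>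
    have : Nonempty ι := Fintype.card_pos_iff.1 (by omega)
    obtain ⟨a⟩ := this
    have h1 := mindeg hO h3 a x
    obtain ⟨y, hy⟩ := Finset.card_pos.1 (by omega : 0 < (N (G a) x).card)
    have hy' : (G a).Adj x y := by simpa [N] using hy
    have := snoc (G := G) (m := 1) (p := fun _ => x) (f := fun _ => a) (a := a) (y := y)
      ⟨by intros; omega, by intros; omega, by intros; omega⟩ le_rfl
      (by intro i hi; omega) (by intro i hi; exact hy'.ne) hy'
    exact ⟨_, _, this, 0, by omega, by simp⟩
  | succ m hm ih =>
    obtain ⟨p, f, h, k, hk, hx⟩ := ih (by omega)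
    obtain ⟨a, b, hab, ha, hb⟩ := spare2 (f := f) (m := m) (by omega) (by omega)
    rcases key hO h hm hab ha hb with ⟨c, g, h1, h2⟩ | h1
    · obtain ⟨e, he⟩ := h1.spare (by omega) (by omega)
      obtain ⟨j, y, hy, hadj⟩ := out_edge hO h1 (by omega) (by omega) e
      have hw := h1.window (j + 1) m le_rfl
      have hs := snoc hw (by omega) (a := e) (fun i _ => he _) (y := y) (fun i _ => hy _)
        (by
          try simp only
          rw [show j + 1 + (m - 1) = j + m by omega, h1.vper]
          exact hadj)
      obtain ⟨l, hl⟩ := h2 k hk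
      refine ⟨_, _, hs, ?_⟩
      -- locate `x`
      have : ∃ i, i < m ∧ c (j + 1 + i) = c l := by
        refine ⟨(l + (j + 1) * (m - 1)) % m, Nat.mod_lt _ (by omega), ?_⟩
        rw [← Function.Periodic.map_mod_nat h1.vper (j + 1 + _),
          ← Function.Periodic.map_mod_nat h1.vper l]
        congr 1
        rw [Nat.add_mod_mod]
        have : j + 1 + (l + (j + 1) * (m - 1)) = l + (j + 1) * m := by
          obtain ⟨t, rfl⟩ : ∃ t, m = t + 1 := ⟨m - 1, by omega⟩
          simp only [Nat.add_sub_cancel]; ring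
        rw [this, Nat.add_mul_mod_self_right]
      obtain ⟨i, hi, hci⟩ := this
      exact ⟨i, by omega, by simp only [hi, if_true]; rw [hci, hl, hx]⟩
    · have : 0 < (NO (G a) m p (p 0)).card ∨ 0 < (NO (G b) m p (p (m - 1))).card := by omega
      rcases this with hp | hp
      · obtain ⟨y, hy⟩ := Finset.card_pos.1 hp
        simp only [NO, N, Finset.mem_filter, Finset.mem_univ, true_and] at hy
        have hs := snoc (rev h) (by omega) (a := a) (fun i hi => ha _ (by omega)) (y := y)
          (fun i hi => hy.2 _ (by omega)) (by simpa using hy.1)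
        refine ⟨_, _, hs, m - 1 - k, by omega, ?_⟩
        simp only [show m - 1 - k < m by omega, if_true]
        rw [show m - 1 - (m - 1 - k) = k by omega, hx]
      · obtain ⟨y, hy⟩ := Finset.card_pos.1 hp
        simp only [NO, N, Finset.mem_filter, Finset.mem_univ, true_and] at hy
        have hs := snoc h (by omega) (a := b) hb (y := y) hy.2 hy.1
        exact ⟨_, _, hs, k, by omega, by simp [hk, hx]⟩

lemma first (hO : Ore G) (hcard : Fintype.card ι = Fintype.card V) {m : ℕ} (hm : 2 ≤ m)
    (hmn : m + 1 = Fintype.card V) (x : V) : Thru G m x ∨ Thru G (m + 1) x := by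
  obtain ⟨p, f, h, k, hk, hx⟩ := grow hO hcard (by omega) x m hm (by omega)
  obtain ⟨a, b, hab, ha, hb⟩ := spare2 (f := f) (m := m) (by omega) (by omega)
  rcases key hO h hm hab ha hb with ⟨c, g, h1, h2⟩ | h1
  · obtain ⟨j, hj⟩ := h2 k hk
    left
    rw [← hx, ← hj]
    exact h1.thru j
  · right
    have h2 := NO_le h a (p 0)
    have h3 := NO_le h b (p (m - 1))
    obtain ⟨y, hy⟩ := Finset.card_pos.1 (by omega : 0 < (NO (G a) m p (p 0)).card)
    simp only [NO, N, Finset.mem_filter, Finset.mem_univ, true_and] at hy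
    have hyb : (G b).Adj (p (m - 1)) y := by
      by_contra hn
      have := NO_lt h b _ hy.2 hn
      omega
    obtain ⟨c, g, h4, h5⟩ := close h (by omega) hab ha hb hy.2 hy.1 hyb
    rw [← hx, ← h5 k hk]
    exact h4.thru k

/-- Hamilton cycle case. -/
lemma ham (hO : Ore G) {m : ℕ} (hm : 6 ≤ m)
    (hmn : m + 2 = Fintype.card V) (x : V) (h : Thru G (m + 2) x) : Thru G m x := by
  by_contra hno
  obtain ⟨c, g, hc, hx⟩ := h
  have hloc : ∀ i, 1 ≤ i → i ≤ 4 →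
      (G (g i)).Adj (c i) (c (i + 2)) ∨ (G (g (i - 1))).Adj (c (i - 1)) (c (i + 1)) := by
    intro i hi hi4
    have hw := hc.window (i + 2) m (by omega)
    have hne : ∀ k l, k < m + 2 → l < m + 2 → (i - 1 + k) % (m + 2) = (i - 1 + l) % (m + 2) →
      k = l := fun k l hk hl => mod_cancel hk hl
    have := two_off hO hw (by omega) hmn (a := g i) (b := g (i - 1)) (x := x)
      (y := c i) (z := c (i + 1))
      (by
        intro e
        have := hne 1 0 (by omega) (by omega)
          (by rw [show i - 1 + 1 = i by omega]; exact hc.cinj _ _ e)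
        omega)
      (by
        intro j hj e
        have := hne (j + 3) 1 (by omega) (by omega)
          (by
            rw [show i - 1 + 1 = i by omega, show i - 1 + (j + 3) = i + 2 + j by omega]
            exact hc.cinj _ _ e)
        omega)
      (by
        intro j hj e
        have := hne (j + 3) 0 (by omega) (by omega)
          (by
            rw [show i - 1 + (j + 3) = i + 2 + j by omega]
            exact hc.cinj _ _ e)
        omega)
      ⟨m - i, by omega, by
        try simp only
        rw [show i + 2 + (m - i) = 0 + (m + 2) by omega, hc.vper, hx]⟩
      hno
      (by
        intro j hj e
        have := mod_cancel (m := m + 2) (k := i) (i := 2 + j) (j := 0) (by omega) (by omega)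
          (by rw [← add_assoc]; exact hc.vinj _ _ e)
        omega)
      (by
        intro j hj e
        have := mod_cancel (m := m + 2) (k := i) (i := 2 + j) (j := 1) (by omega) (by omega)
          (by rw [← add_assoc]; exact hc.vinj _ _ e)
        omega)
    rcases this with e | e
    · left; exact e.symm
    · right
      try simp only at e
      rw [show i + 2 + (m - 1) = i - 1 + (m + 2) by omega, hc.vper] at e
      exact e
  have hs : ∀ i, 1 ≤ i → i ≤ 4 → ∃ s, (s = i ∨ s = i + 1) ∧
      (G (g (s - 1))).Adj (c (s - 1)) (c (s + 1)) := by
    intro i hi hi4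
    rcases hloc i hi hi4 with e | e
    · exact ⟨i + 1, Or.inr rfl, e⟩
    · exact ⟨i, Or.inl rfl, e⟩
  obtain ⟨s, hs1, es⟩ := hs 1 (by omega) (by omega)
  obtain ⟨t, ht1, et⟩ := hs 4 (by omega) (by omega)
  have hw := hc.window 0 (m + 2) le_rfl
  simp only [zero_add] at hw
  have k1 := skip hw (s := t) (by omega) (by omega) et
  have k2 := skip k1 (s := s) (by omega) (by omega)
    (by
      simp only [show s - 1 < t by omega, show s + 1 < t by omega, if_true]
      exact es)
  have hcl := hc.adj (m + 1)
  rw [show m + 1 + 1 = 0 + (m + 2) by omega, hc.vper] at hcl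
  obtain ⟨c', g', h1, h2⟩ := mk_cycle k2 (by omega) (a := g (m + 1))
    (by
      intro j hj e
      try simp only at e
      have : ∀ r, r < m + 1 → g r ≠ g (m + 1) := by
        intro r hr e
        have := hc.cinj _ _ e
        rw [Nat.mod_eq_of_lt (by omega), Nat.mod_eq_of_lt (by omega)] at this
        omega
      split_ifs at e
      all_goals exact this _ (by omega) e)
    (by
      simp only [show ¬ (m + 2 - 1 - 1 - 1 < s) by omega,
        show ¬ (m + 2 - 1 - 1 - 1 + 1 < t) by omega, if_false, show 0 < s by omega,
        show 0 < t by omega, if_true]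
      rw [show m + 2 - 1 - 1 - 1 + 1 + 1 = m + 1 by omega]
      exact hcl)
  have h3 := h2 0 (by omega)
  simp only [show 0 < s by omega, show 0 < t by omega, if_true] at h3
  exact hno ⟨c', g', h1, by rw [h3, hx]⟩

/-- Near-Hamilton cycle case. -/
lemma near (hO : Ore G) (hcard : Fintype.card ι = Fintype.card V) {m : ℕ} (hm : 6 ≤ m)
    (hmn : m + 2 = Fintype.card V) (x : V) (h : Thru G (m + 1) x) : Thru G m x := by
  by_contra hno
  have hnh : ¬ Thru G (m + 2) x := fun h => hno (ham hO hm hmn x h)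
  obtain ⟨c, g, hc, hx⟩ := h
  obtain ⟨e, he⟩ := hc.spare (by omega) (by omega)
  obtain ⟨y, hy⟩ := hc.off (by omega) (by omega)
  have hA : ∀ i, 1 ≤ i → i ≤ m → ¬ (G e).Adj (c i) y := by
    intro i hi him hadj
    have hne : ∀ k l, k < m + 1 → l < m + 1 → (i - 1 + k) % (m + 1) = (i - 1 + l) % (m + 1) →
      k = l := fun k l hk hl => mod_cancel hk hl
    have hsp : ∀ k, Sp (m + 1) (fun i => g (k + 1 + i)) (g k) := by
      intro k j hj ee
      have h0 := hc.cinj _ _ ee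
      have := mod_cancel (m := m + 1) (k := k) (i := 1 + j) (j := 0) (by omega) (by omega)
        (by rw [← add_assoc]; exact h0)
      omega
    -- `x` lies on every full window
    have hxw : ∀ k, k ≤ m + 1 → 1 ≤ k → c (k + (m + 1 - k)) = x := by
      intro k hk _
      rw [show k + (m + 1 - k) = 0 + (m + 1) by omega, hc.vper, hx]
    have h1 : ¬ (G (g i)).Adj (c (i + 1)) y := by
      intro e2
      obtain ⟨c', g', h1, h2⟩ := close (hc.window (i + 1) (m + 1) le_rfl) (by omega)
        (a := g i) (b := e) (he i) (hsp i) (fun j _ => he _) (y := y) (fun j _ => hy _) e2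
        (by
          try simp only
          rw [show i + 1 + (m + 1 - 1) = i + (m + 1) by omega, hc.vper]
          exact hadj)
      have h3 := h2 (m + 1 - (i + 1)) (by omega)
      rw [hxw (i + 1) (by omega) (by omega)] at h3
      exact hnh (h3 ▸ h1.thru _)
    have h2 : ¬ (G (g (i - 1))).Adj (c (i - 1)) y := by
      intro e2
      have hs := hsp (i - 1)
      rw [show i - 1 + 1 = i by omega] at hs
      obtain ⟨c', g', h1, h2⟩ := close (hc.window i (m + 1) le_rfl) (by omega)
        (a := e) (b := g (i - 1)) (he _).symm (fun j _ => he _) hs (y := y)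
        (fun j _ => hy _) hadj
        (by
          try simp only
          rw [show i + (m + 1 - 1) = i - 1 + (m + 1) by omega, hc.vper]
          exact e2)
      have h3 := h2 (m + 1 - i) (by omega)
      rw [hxw i (by omega) (by omega)] at h3
      exact hnh (h3 ▸ h1.thru _)
    have := two_off hO (hc.window (i + 1) m (by omega)) (by omega) hmn (a := g i) (b := g (i - 1))
      (x := x) (y := y) (z := y)
      (by
        intro e
        have := hne 1 0 (by omega) (by omega)
          (by rw [show i - 1 + 1 = i by omega]; exact hc.cinj _ _ e)
        omega)
      (fun j hj => hsp i j (by omega))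
      (by
        intro j hj e
        have := hne (j + 2) 0 (by omega) (by omega)
          (by
            rw [show i - 1 + (j + 2) = i + 1 + j by omega]
            exact hc.cinj _ _ e)
        omega)
      ⟨m + 1 - (i + 1), by omega, hxw (i + 1) (by omega) (by omega)⟩
      hno (fun j _ => hy _) (fun j _ => hy _)
    rcases this with e3 | e3
    · exact h1 e3
    · rw [show i + 1 + (m - 1) = i - 1 + (m + 1) by omega, hc.vper] at e3
      exact h2 e3
  have hd := mindeg hO (by omega) e y
  have hoff := off_card (hc.window 0 (m + 1) le_rfl)
  have hsub : N (G e) y ⊆ {c 0} := by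
    classical
    intro w hw
    have hw' : (G e).Adj y w := by simpa [N] using hw
    rw [Finset.mem_singleton]
    by_cases ho : Off (m + 1) (fun i => c (0 + i)) w
    · have hyo : Off (m + 1) (fun i => c (0 + i)) y := fun j _ => hy _
      have : (Finset.univ.filter (Off (m + 1) (fun i => c (0 + i)))).card ≤ 1 := by omega
      exact absurd (Finset.card_le_one.1 this y (by simpa using hyo) w (by simpa using ho)) hw'.ne
    · simp only [Off, not_forall, not_not, zero_add] at ho
      obtain ⟨i, hi, rfl⟩ := ho
      by_cases hi0 : i = 0
      · rw [hi0]
      · exact absurd hw'.symm (hA i (by omega) (by omega))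
  have := Finset.card_le_card hsub
  simp at this
  omega

end count

end RB

theorem stmt10 {V : Type*} [Fintype V] {n : ℕ} (hn : 8 ≤ n)
    (hV : Fintype.card V = n)
    (G : ZMod n → SimpleGraph V) [∀ i, DecidableRel (G i).Adj]
    (hσ : ∀ u v : V, u ≠ v → (∃ i, ¬ (G i).Adj u v) →
      ∀ p q, n ≤ (G p).degree u + (G q).degree v) :
    ∀ x : V, HasRainbowCycleThrough G (n - 2) x := by
  intro x
  classical
  have : NeZero n := ⟨by omega⟩
  have hO : RB.Ore G := by
    intro u v huv hi p q
    have := hσ u v huv hi p q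
    rw [hV]
    convert this using 2
    all_goals
      rw [← SimpleGraph.card_neighborFinset_eq_degree]
      congr 1
      ext w
      simp [RB.N]
  obtain ⟨m, rfl⟩ : ∃ m, n = m + 2 := ⟨n - 2, by omega⟩
  have hcard : Fintype.card (ZMod (m + 2)) = Fintype.card V := by rw [hV, ZMod.card]
  have hT : RB.Thru G m x := by
    rcases RB.first hO hcard (m := m + 1) (by omega) (by omega) x with h | h
    · exact RB.near hO hcard (by omega) (by omega) x h
    · exact RB.ham hO (by omega) (by omega) x h
  obtain ⟨c, g, hc, hx⟩ := hT
  show HasRainbowCycleThrough G m x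
  have hm0 : NeZero m := ⟨by omega⟩
  refine ⟨fun i => c i.val, fun i => g i.val, ⟨?_, ?_, ?_⟩, 0, by simpa using hx⟩
  · intro i j hij
    have := hc.vinj _ _ hij
    rw [Nat.mod_eq_of_lt (ZMod.val_lt i), Nat.mod_eq_of_lt (ZMod.val_lt j)] at this
    exact ZMod.val_injective m this
  · intro i j hij
    have := hc.cinj _ _ hij
    rw [Nat.mod_eq_of_lt (ZMod.val_lt i), Nat.mod_eq_of_lt (ZMod.val_lt j)] at this
    exact ZMod.val_injective m this
  · intro i
    have h1 : c (i + 1).val = c (i.val + 1) := by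
      have h3 : (i + 1).val = (i.val + 1) % m := by
        rw [ZMod.val_add, ZMod.val_one'' (by omega)]
      rw [h3]
      exact Function.Periodic.map_mod_nat hc.vper _
    have h2 := hc.adj i.val
    rw [← h1] at h2
    exact h2
end

section
/- Let n ≥ 8 and let 𝒢 = {G_1, …, G_n} be a family of n graphs (not necessarily distinct) on a common vertex set V with |V| = n, with σ(𝒢) ≥ n. Let x ∈ V and let ℓ be an integer with 8 ≤ ℓ ≤ n. If x is contained in a rainbow cycle of length ℓ in 𝒢, then x is contained in a rainbow cycle of length ℓ − 2 in 𝒢. -/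
/-- A walk from `u` to `v` with vertex list `vs` and edge-colour list `cs`. -/
inductive RPath {V ι : Type*} (G : ι → SimpleGraph V) : V → V → List V → List ι → Prop
  | nil (u : V) : RPath G u u [u] []
  | cons {u w v : V} {vs : List V} {cs : List ι} (c : ι) (h : (G c).Adj u w)
      (p : RPath G w v vs cs) : RPath G u v (u :: vs) (c :: cs)

theorem RPath.append {V ι : Type*} {G : ι → SimpleGraph V} {u v u' v' : V} {vs vs' : List V}
    {cs cs' : List ι} (c : ι) (p : RPath G u v vs cs) (h : (G c).Adj v u')
    (q : RPath G u' v' vs' cs') : RPath G u v' (vs ++ vs') (cs ++ c :: cs') := by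
  induction p with
  | nil u => exact RPath.cons c h q
  | cons d hd p ih => exact RPath.cons d hd (ih h)

theorem RPath.reverse {V ι : Type*} {G : ι → SimpleGraph V} {u v : V} {vs : List V}
    {cs : List ι} (p : RPath G u v vs cs) : RPath G v u vs.reverse cs.reverse := by
  induction p with
  | nil u => exact RPath.nil u
  | cons d hd p ih =>
    have := RPath.append d ih hd.symm (RPath.nil _)
    simpa using this

theorem RPath.length_eq {V ι : Type*} {G : ι → SimpleGraph V} {u v : V} {vs : List V}
    {cs : List ι} (p : RPath G u v vs cs) : vs.length = cs.length + 1 := by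
  induction p with
  | nil u => rfl
  | cons d hd p ih => simp [ih]

theorem RPath.get_zero {V ι : Type*} {G : ι → SimpleGraph V} {u v : V} {vs : List V}
    {cs : List ι} (p : RPath G u v vs cs) : vs[0]? = some u := by
  cases p <;> rfl

theorem RPath.get_last {V ι : Type*} {G : ι → SimpleGraph V} {u v : V} {vs : List V}
    {cs : List ι} (p : RPath G u v vs cs) : vs[cs.length]? = some v := by
  induction p with
  | nil u => rfl
  | cons d hd p ih => simpa using ih

theorem RPath.adj {V ι : Type*} {G : ι → SimpleGraph V} {u v : V} {vs : List V}
    {cs : List ι} (p : RPath G u v vs cs) :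
    ∀ (i : ℕ) (a b : V) (c : ι), vs[i]? = some a → vs[i+1]? = some b → cs[i]? = some c →
      (G c).Adj a b := by
  induction p with
  | nil u => intro i a b c h1 h2 h3; simp at h3
  | cons d hd p ih =>
    intro i a b c h1 h2 h3
    cases i with
    | zero =>
      have := p.get_zero
      simp at h1 h2 h3
      rw [this] at h2
      simp at h2
      subst h1 h2 h3
      exact hd
    | succ i =>
      simp only [List.getElem?_cons_succ] at h1 h2 h3
      exact ih i a b c h1 h2 h3

theorem RPath.close {V ι : Type*} {G : ι → SimpleGraph V} {u v : V} {vs : List V}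
    {cs : List ι} (p : RPath G u v vs cs) (c : ι) (h : (G c).Adj v u)
    (hvs : vs.Nodup) (hcs : (c :: cs).Nodup) (m : ℕ) (hm : vs.length = m) (x : V)
    (hx : x ∈ vs) : HasRainbowCycleThrough G m x := by
  have hl := p.length_eq
  have hm0 : m = cs.length + 1 := by omega
  have : NeZero m := ⟨by omega⟩
  have hcs' : (cs ++ [c]).Nodup := by
    rw [← List.nodup_reverse]; simp only [List.reverse_append]; simpa using hcs
  have hlen : (cs ++ [c]).length = m := by simp [hm0]
  refine ⟨fun i => vs[i.val]'(by rw [hm]; exact ZMod.val_lt i),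
    fun i => (cs ++ [c])[i.val]'(by rw [hlen]; exact ZMod.val_lt i), ⟨?_, ?_, ?_⟩, ?_⟩
  · intro i j hij
    exact ZMod.val_injective m ((hvs.getElem_inj_iff).1 hij)
  · intro i j hij
    exact ZMod.val_injective m ((hcs'.getElem_inj_iff).1 hij)
  · intro i
    have hi := ZMod.val_lt i
    by_cases hlt : i.val + 1 < m
    · have e : (i + 1).val = i.val + 1 := by
        have := ZMod.val_add_of_lt (a := i) (b := 1) (by
          rw [ZMod.val_one'' (by omega)]; exact hlt)
        rw [this, ZMod.val_one'' (by omega)]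
      simp only [e]
      apply p.adj i.val
      · simp
      · simp
      · rw [List.getElem_append_left (by omega)]; simp
    · have e1 : i.val = cs.length := by omega
      have e : (i + 1).val = 0 := by
        have : i + 1 = 0 := by
          rw [← ZMod.natCast_zmod_val i]
          have : ((i.val + 1 : ℕ) : ZMod m) = 0 := by
            rw [show i.val + 1 = m by omega]; simp
          simpa using this
        rw [this]; simp
      have h0 := p.get_zero
      have h1 := p.get_last
      rw [List.getElem?_eq_some_iff] at h0 h1
      obtain ⟨_, h0⟩ := h0
      obtain ⟨_, h1⟩ := h1
      simp only [e, e1, h0, h1]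
      simpa using h
  · obtain ⟨i, hi, rfl⟩ := List.getElem_of_mem hx
    refine ⟨(i : ZMod m), ?_⟩
    have : (i : ZMod m).val = i := ZMod.val_cast_of_lt (by omega)
    simp only [this]

theorem RPath.cross {V ι : Type*} {G : ι → SimpleGraph V} (A B : V → Bool) {u v : V}
    {vs : List V} {cs : List ι} (p : RPath G u v vs cs) :
    (∃ s t vs1 cs1 c vs2 cs2, RPath G u s vs1 cs1 ∧ RPath G t v vs2 cs2 ∧ vs = vs1 ++ vs2 ∧
      cs = cs1 ++ c :: cs2 ∧ B s = true ∧ A t = true) ∨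
    vs.countP A + vs.countP B + 1 ≤
      vs.length + (if A u then 1 else 0) + (if B v then 1 else 0) := by
  induction p with
  | nil u => right; simp [List.countP_cons]
  | @cons u w v vs cs d hd p ih =>
    rcases ih with ⟨s, t, vs1, cs1, c, vs2, cs2, h1, h2, rfl, rfl, h3, h4⟩ | h
    · left
      exact ⟨s, t, u :: vs1, d :: cs1, c, vs2, cs2, RPath.cons d hd h1, h2, rfl, rfl, h3, h4⟩
    · by_cases hc : B u = true ∧ A w = true
      · left
        exact ⟨u, w, [u], [], d, vs, cs, RPath.nil u, p, rfl, rfl, hc.1, hc.2⟩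
      · right
        simp only [List.countP_cons, List.length_cons]
        by_cases h1 : B u = true
        · have h2 : A w = false := by simpa [h1] using hc
          simp only [h1, h2] at h ⊢
          simp at h ⊢
          omega
        · have h1 : B u = false := by simpa using h1
          simp only [h1]
          split_ifs at h ⊢ <;> simp_all <;> omega

theorem ore_step {V : Type*} [Fintype V] {n : ℕ}
    (hV : Fintype.card V = n)
    (G : ZMod n → SimpleGraph V) [∀ i, DecidableRel (G i).Adj]
    (hσ : ∀ u v : V, u ≠ v → (∃ i, ¬ (G i).Adj u v) →
      ∀ p q, n ≤ (G p).degree u + (G q).degree v)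
    {u v : V} {vs : List V} {cs : List (ZMod n)} (p : RPath G u v vs cs)
    (hvs : vs.Nodup) (a b : ZMod n) (huv : u ≠ v) (hcs : (a :: b :: cs).Nodup)
    (x : V) (hx : x ∈ vs) (m : ℕ) (hm : vs.length = m) :
    HasRainbowCycleThrough G m x ∨ ∃ w, w ∉ vs ∧ (G b).Adj u w ∧ (G a).Adj v w := by
  classical
  by_cases hadj : (G a).Adj v u
  · left
    exact p.close a hadj hvs (by grind) m hm x hx
  have hd := hσ v u huv.symm ⟨a, hadj⟩ a b
  rcases p.cross (fun w => decide ((G b).Adj u w)) (fun w => decide ((G a).Adj v w)) with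
    ⟨s, t, vs1, cs1, c, vs2, cs2, h1, h2, rfl, rfl, h3, h4⟩ | h
  · left
    simp only [decide_eq_true_eq] at h3 h4
    have q := h1.append a h3.symm h2.reverse
    refine q.close b h4.symm ?_ ?_ m ?_ x ?_
    · refine (List.Perm.nodup_iff ?_).1 hvs
      exact (List.Perm.append_left _ (List.reverse_perm vs2).symm)
    · have : (a :: b :: (cs1 ++ cs2)).Nodup := by
        refine List.Nodup.sublist ?_ hcs
        simp
      refine (List.Perm.nodup_iff ?_).1 this
      refine (List.Perm.swap _ _ _).trans (List.Perm.cons _ ?_)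
      refine List.perm_middle.symm.trans (List.Perm.append_left _ (List.Perm.cons _ ?_))
      exact (List.reverse_perm cs2).symm
    · simpa using hm
    · simpa using hx
  · right
    by_contra hno
    push Not at hno
    simp at h
    have key : ∀ (A : V → Prop) [DecidablePred A], vs.countP (fun w => decide (A w)) =
        (vs.toFinset.filter A).card := by
      intro A _
      rw [List.countP_eq_length_filter, ← List.toFinset_card_of_nodup (hvs.filter _)]
      congr 1
      ext; simp
    rw [key, key] at h
    have deg : ∀ (c : ZMod n) (y : V), (G c).degree y =
        (vs.toFinset.filter (fun w => (G c).Adj y w)).card +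
        (vs.toFinsetᶜ.filter (fun w => (G c).Adj y w)).card := by
      intro c y
      rw [← Finset.card_union_of_disjoint, ← Finset.filter_union, Finset.union_compl,
        ← SimpleGraph.card_neighborFinset_eq_degree]
      · congr 1
        ext; simp
      · exact Finset.disjoint_filter_filter disjoint_compl_right
    have hout : (vs.toFinsetᶜ.filter (fun w => (G a).Adj v w)).card +
        (vs.toFinsetᶜ.filter (fun w => (G b).Adj u w)).card ≤ vs.toFinsetᶜ.card := by
      rw [← Finset.card_union_of_disjoint]
      · apply Finset.card_le_card
        intro w; simp; tauto
      · rw [Finset.disjoint_left]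
        intro w h1 h2
        simp at h1 h2
        exact hno w h1.1 h2.2 h1.2
    have hc : vs.toFinset.card + vs.toFinsetᶜ.card = n := by
      rw [Finset.card_add_card_compl, hV]
    rw [List.toFinset_card_of_nodup hvs] at hc
    rw [deg, deg] at hd
    change (vs.toFinset.filter (fun w => (G b).Adj u w)).card +
      (vs.toFinset.filter (fun w => (G a).Adj v w)).card + 1 ≤ vs.length at h
    omega

theorem RPath.of_fun {V ι : Type*} {G : ι → SimpleGraph V} (f : ℕ → V) (g : ℕ → ι)
    (h : ∀ i, (G (g i)).Adj (f i) (f (i + 1))) (k : ℕ) : ∀ j,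
    RPath G (f j) (f (j + k)) ((List.range' j (k + 1)).map f) ((List.range' j k).map g) := by
  induction k with
  | zero => intro j; exact RPath.nil _
  | succ k ih =>
    intro j
    have := RPath.cons (g j) (h j) (ih (j + 1))
    rw [show j + 1 + k = j + (k + 1) by omega] at this
    simpa [List.range'_succ] using this

theorem main_step {V : Type*} [Fintype V] {n : ℕ} (hn : 8 ≤ n)
    (hV : Fintype.card V = n)
    (G : ZMod n → SimpleGraph V) [∀ i, DecidableRel (G i).Adj]
    (hσ : ∀ u v : V, u ≠ v → (∃ i, ¬ (G i).Adj u v) →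
      ∀ p q, n ≤ (G p).degree u + (G q).degree v)
    (v0 v1 v2 v3 v4 v5 v6 v7 z : V) (c0 c1 c2 c3 c4 c5 c6 e : ZMod n)
    (rs : List V) (ds : List (ZMod n))
    (h0 : (G c0).Adj v0 v1) (h1 : (G c1).Adj v1 v2) (h2 : (G c2).Adj v2 v3)
    (h3 : (G c3).Adj v3 v4) (h4 : (G c4).Adj v4 v5) (h5 : (G c5).Adj v5 v6)
    (h6 : (G c6).Adj v6 v7) (hR : RPath G v7 z rs ds) (he : (G e).Adj z v0)
    (hv : (v0 :: v1 :: v2 :: v3 :: v4 :: v5 :: v6 :: rs).Nodup)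
    (hc : (c0 :: c1 :: c2 :: c3 :: c4 :: c5 :: c6 :: e :: ds).Nodup) :
    HasRainbowCycleThrough G (rs.length + 5) v0 := by
  classical
  have : NeZero n := ⟨by omega⟩
  have h7 : v7 ∈ rs := by
    have := hR.get_zero
    exact List.mem_of_getElem? this
  have hlen := hR.length_eq
  obtain ⟨c, hcn, hcc⟩ : ∃ c, c ∉ (c0 :: c1 :: c2 :: c3 :: c5 :: c6 :: e :: ds) ∧
      (c = c4 → ∀ w, w ∈ (v0 :: v1 :: v2 :: v3 :: v4 :: v5 :: v6 :: rs)) := by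
    by_cases hex : ∃ c, c ∉ (c0 :: c1 :: c2 :: c3 :: c4 :: c5 :: c6 :: e :: ds)
    · obtain ⟨c, h⟩ := hex
      exact ⟨c, by grind, by grind⟩
    · push Not at hex
      refine ⟨c4, by grind, fun _ w => ?_⟩
      have hle : n ≤ ds.length + 8 := by
        have h1 : (Finset.univ : Finset (ZMod n)) ⊆
          (c0 :: c1 :: c2 :: c3 :: c4 :: c5 :: c6 :: e :: ds).toFinset := by
          intro c _; rw [List.mem_toFinset]; exact hex c
        have h2 := Finset.card_le_card h1
        rw [List.toFinset_card_of_nodup hc, Finset.card_univ, ZMod.card] at h2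
        simpa using h2
      have hu : (v0 :: v1 :: v2 :: v3 :: v4 :: v5 :: v6 :: rs).toFinset = Finset.univ := by
        rw [← Finset.card_eq_iff_eq_univ]
        apply le_antisymm (Finset.card_le_univ _)
        rw [List.toFinset_card_of_nodup hv, hV]
        simp; omega
      rw [← List.mem_toFinset, hu]; simp
  have hv' := hv
  have hc' := hc
  simp only [List.nodup_cons, List.mem_cons, not_or] at hv' hc' hcn
  have P0 := RPath.append e (RPath.cons c3 h3 (RPath.cons c4 h4 (RPath.cons c5 h5
    (RPath.cons c6 h6 hR)))) he (RPath.nil v0)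
  have P4 := RPath.append e hR he (RPath.cons c0 h0 (RPath.cons c1 h1 (RPath.cons c2 h2
    (RPath.cons c3 h3 (RPath.nil v4)))))
  have W0 := ore_step hV G hσ P0 (by
      simp only [List.nodup_append, List.nodup_cons, List.cons_append, List.mem_cons,
        List.mem_append, List.not_mem_nil, List.nodup_nil, not_or]
      grind) c0 c1 (by grind) (by
      simp only [List.nodup_append, List.nodup_cons, List.cons_append, List.mem_cons,
        List.mem_append, List.not_mem_nil, List.nodup_nil, not_or]
      grind) v0 (by simp)
    (rs.length + 5) (by simp; try omega)
  have W4 := ore_step hV G hσ P4 (by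
      simp only [List.nodup_append, List.nodup_cons, List.cons_append, List.mem_cons,
        List.mem_append, List.not_mem_nil, List.nodup_nil, not_or]
      grind) c c5 (by grind) (by
      simp only [List.nodup_append, List.nodup_cons, List.cons_append, List.mem_cons,
        List.mem_append, List.not_mem_nil, List.nodup_nil, not_or]
      grind) v0 (by simp)
    (rs.length + 5) (by simp)
  rcases W0 with W0 | ⟨y, hy, hy3, hy0⟩
  · exact W0
  rcases W4 with W4 | ⟨y', hy', hy7, hy4⟩
  · exact W4
  obtain ⟨s, p, q, hs0, hs3, hpq, hp, hq, hs⟩ : ∃ s p q, (G p).Adj v0 s ∧ (G q).Adj s v3 ∧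
      p ≠ q ∧ p ∈ [c0, c1, c2] ∧ q ∈ [c0, c1, c2] ∧
      ((s = v1 ∨ s = v2) ∨ (s ∉ (v0 :: v1 :: v2 :: v3 :: v4 :: v5 :: v6 :: rs) ∧ p = c0)) := by
    by_cases e1 : y = v1
    · subst e1
      exact ⟨y, c0, c1, h0, hy3.symm, by grind, by grind, by grind, by grind⟩
    by_cases e2 : y = v2
    · subst e2
      exact ⟨y, c0, c2, hy0, h2, by grind, by grind, by grind, by grind⟩
    exact ⟨y, c0, c1, hy0, hy3.symm, by grind, by grind, by grind, by grind⟩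
  obtain ⟨s', p', q', hs4, hs7, hpq', hp', hq', hs'⟩ : ∃ s p q, (G p).Adj v4 s ∧
      (G q).Adj s v7 ∧
      p ≠ q ∧ p ∈ [c4, c5, c6, c] ∧ q ∈ [c4, c5, c6, c] ∧
      ((s = v5 ∨ s = v6) ∨ (s ∉ (v0 :: v1 :: v2 :: v3 :: v4 :: v5 :: v6 :: rs) ∧ p = c)) := by
    by_cases e1 : y' = v5
    · subst e1
      exact ⟨y', c4, c5, h4, hy7.symm, by grind, by grind, by grind, by grind⟩
    by_cases e2 : y' = v6
    · subst e2
      exact ⟨y', c, c6, hy4, h6, by grind, by grind, by grind, by grind⟩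
    exact ⟨y', c, c5, hy4, hy7.symm, by grind, by grind, by grind, by grind⟩
  by_cases hss : s = s'
  · subst hss
    have hout : s ∉ (v0 :: v1 :: v2 :: v3 :: v4 :: v5 :: v6 :: rs) ∧ p = c0 ∧ p' = c := by grind
    obtain ⟨ho, rfl, rfl⟩ := hout
    have hne : p' ≠ c4 := fun h => ho (hcc h s)
    have Q := RPath.cons p hs0 (RPath.cons p' hs4.symm (RPath.cons c4 h4 (RPath.cons c5 h5
      (RPath.cons c6 h6 hR))))
    exact Q.close e he (by
      simp only [List.nodup_append, List.nodup_cons, List.cons_append, List.mem_cons,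
        List.mem_append, List.not_mem_nil, List.nodup_nil, not_or]
      grind) (by
      simp only [List.nodup_append, List.nodup_cons, List.cons_append, List.mem_cons,
        List.mem_append, List.not_mem_nil, List.nodup_nil, not_or]
      grind) _ (by simp) v0 (by simp)
  · have Q := RPath.cons p hs0 (RPath.cons q hs3 (RPath.cons c3 h3 (RPath.cons p' hs4
      (RPath.cons q' hs7 hR))))
    simp only [List.mem_cons, List.not_mem_nil, or_false] at hp hq hp' hq'
    have f1 : ∀ r, (r = c0 ∨ r = c1 ∨ r = c2) → r ≠ c3 ∧ r ≠ e ∧ r ∉ ds ∧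
        r ≠ c4 ∧ r ≠ c5 ∧ r ≠ c6 ∧ r ≠ c := by
      clear hp hq hp' hq' hs hs' hcc P0 P4 Q hσ hR hv hc
      rintro r (rfl | rfl | rfl) <;> grind
    have f2 : ∀ r, (r = c4 ∨ r = c5 ∨ r = c6 ∨ r = c) → r ≠ c3 ∧ r ≠ e ∧ r ∉ ds := by
      clear hp hq hp' hq' hs hs' hcc P0 P4 Q hσ hR hv hc f1
      rintro r (rfl | rfl | rfl | rfl) <;> grind
    have gp := f1 p hp
    have gq := f1 q hq
    have gp' := f2 p' hp'
    have gq' := f2 q' hq'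
    have f3 : ∀ r t, (r ≠ c3 ∧ r ≠ e ∧ r ∉ ds ∧ r ≠ c4 ∧ r ≠ c5 ∧ r ≠ c6 ∧ r ≠ c) →
        (t = c4 ∨ t = c5 ∨ t = c6 ∨ t = c) → r ≠ t := by
      rintro r t ⟨-, -, -, a1, a2, a3, a4⟩ (rfl | rfl | rfl | rfl) <;> assumption
    have k1 := f3 p p' gp hp'
    have k2 := f3 p q' gp hq'
    have k3 := f3 q p' gq hp'
    have k4 := f3 q q' gq hq'
    clear hp hq hp' hq' f1 f2 f3
    refine Q.close e he ?_ ?_ _ (by simp) v0 (by simp)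
    · simp only [List.nodup_cons, List.mem_cons, not_or]
      clear hc hc' hcc
      grind
    · simp only [List.nodup_cons, List.mem_cons, not_or]
      clear hs hs' hcc P0 P4 Q hσ hR hv hc
      grind

theorem stmt11 {V : Type*} [Fintype V] {n : ℕ} (hn : 8 ≤ n)
    (hV : Fintype.card V = n)
    (G : ZMod n → SimpleGraph V) [∀ i, DecidableRel (G i).Adj]
    (hσ : ∀ u v : V, u ≠ v → (∃ i, ¬ (G i).Adj u v) →
      ∀ p q, n ≤ (G p).degree u + (G q).degree v)
    (x : V) (ℓ : ℕ) (hℓ : 8 ≤ ℓ) (hℓn : ℓ ≤ n)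
    (hx : HasRainbowCycleThrough G ℓ x) :
    HasRainbowCycleThrough G (ℓ - 2) x := by
  obtain ⟨c, φ, ⟨hc, hφ, hadj⟩, i0, rfl⟩ := hx
  obtain ⟨k, rfl⟩ : ∃ k, ℓ = k + 8 := ⟨ℓ - 8, by omega⟩
  set f : ℕ → V := fun i => c (i0 + (i : ZMod (k + 8))) with hf
  set g : ℕ → ZMod n := fun i => φ (i0 + (i : ZMod (k + 8))) with hg
  have hfg : ∀ i, (G (g i)).Adj (f i) (f (i + 1)) := by
    intro i
    have := hadj (i0 + (i : ZMod (k + 8)))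
    simpa [hf, hg, add_assoc] using this
  have inj : ∀ i ∈ List.range' 0 (k + 8), ∀ j ∈ List.range' 0 (k + 8),
      (i : ZMod (k + 8)) = (j : ZMod (k + 8)) → i = j := by
    intro i hi j hj h
    rw [ZMod.natCast_eq_natCast_iff'] at h
    simp at hi hj
    rwa [Nat.mod_eq_of_lt (by omega), Nat.mod_eq_of_lt (by omega)] at h
  have nf : ((List.range' 0 (k + 8)).map f).Nodup := by
    refine List.Nodup.map_on (fun i hi j hj h => inj i hi j hj ?_) (List.nodup_range')
    exact add_left_cancel (hc h)
  have ng : ((List.range' 0 (k + 8)).map g).Nodup := by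
    refine List.Nodup.map_on (fun i hi j hj h => inj i hi j hj ?_) (List.nodup_range')
    exact add_left_cancel (hφ h)
  have R := RPath.of_fun f g hfg k 7
  have he := hfg (7 + k)
  have hwrap : f (7 + k + 1) = f 0 := by
    have : ((7 + k + 1 : ℕ) : ZMod (k + 8)) = 0 := by
      rw [show 7 + k + 1 = k + 8 by omega]; exact ZMod.natCast_self _
    simp only [hf]; rw [this]; simp
  rw [hwrap] at he
  have M := main_step hn hV G hσ (f 0) (f 1) (f 2) (f 3) (f 4) (f 5) (f 6) (f 7) (f (7 + k))
    (g 0) (g 1) (g 2) (g 3) (g 4) (g 5) (g 6) (g (7 + k)) _ _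
    (hfg 0) (hfg 1) (hfg 2) (hfg 3) (hfg 4) (hfg 5) (hfg 6) R he
    (by simpa [List.range'_succ] using nf)
    (by
      have e : List.range' 0 (k + 8) = [0, 1, 2, 3, 4, 5, 6] ++ (List.range' 7 k ++ [7 + k]) := by
        have : List.range' 7 k ++ [7 + k] = List.range' 7 (k + 1) := by
          rw [List.range'_concat]; simp
        rw [this]; rfl
      rw [e, List.map_append, List.map_append] at ng
      refine (List.Perm.nodup_iff ?_).1 ng
      exact List.Perm.append_left ([0, 1, 2, 3, 4, 5, 6].map g) List.perm_append_comm)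
  have h0 : f 0 = c i0 := by simp [hf]
  rw [h0] at M
  simpa using M
end

section
/- Let n ≥ 8 and let 𝒢 = {G_1, …, G_n} be a family of n graphs (not necessarily distinct) on a common vertex set V with |V| = n. If σ(𝒢) ≥ n, then either every vertex of V is contained in a rainbow cycle of length 5 in 𝒢, or n is even and G_1 = ⋯ = G_n = K_{n/2,n/2}. -/
namespace Rainbow5

open Finset

/-- Neighbourhood system of a graph family with the Ore-type condition. -/
structure Fam {V ι : Type*} [Fintype V] [Fintype ι] (n : ℕ) (N : ι → V → Finset V) : Prop where
  hn : 8 ≤ n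
  cV : Fintype.card V = n
  cI : Fintype.card ι = n
  symm : ∀ i u v, u ∈ N i v → v ∈ N i u
  irr : ∀ i v, v ∉ N i v
  ore : ∀ u v, u ≠ v → ∀ i, v ∉ N i u → ∀ p q, n ≤ (N p u).card + (N q v).card

/-- No rainbow five-cycle through `x`. -/
def NoC {V ι : Type*} (N : ι → V → Finset V) (x : V) : Prop :=
  ∀ a b c d : V, ∀ i j k l m : ι,
    x ≠ b → x ≠ c → a ≠ c → a ≠ d → b ≠ d →
    i ≠ j → i ≠ k → i ≠ l → i ≠ m → j ≠ k → j ≠ l → j ≠ m → k ≠ l → k ≠ m → l ≠ m →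
    a ∈ N i x → b ∈ N j a → c ∈ N k b → d ∈ N l c → x ∈ N m d → False

section
variable {V ι : Type*} [Fintype V] [Fintype ι] [DecidableEq V] [DecidableEq ι]
  {n : ℕ} {N : ι → V → Finset V}

lemma Fam.fresh (h : Fam n N) (S : Finset ι) (hS : S.card < 8) : ∃ c, c ∉ S := by
  by_contra hc
  push Not at hc
  have : S = univ := by ext; simp [hc]
  have h1 := h.cI
  have h2 := h.hn
  rw [this, Finset.card_univ] at hS
  omega

lemma Fam.ne (h : Fam n N) {i : ι} {u v : V} (huv : u ∈ N i v) : u ≠ v := by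
  rintro rfl
  exact h.irr _ _ huv

lemma Fam.two_le (h : Fam n N) (i : ι) (v : V) : 2 ≤ (N i v).card := by
  by_contra hc
  have h2 := h.hn
  have hcard : (insert v (N i v)).card ≤ 2 := by
    have := Finset.card_insert_le v (N i v)
    omega
  have : ∃ u, u ∉ insert v (N i v) := by
    by_contra hu
    push Not at hu
    have hu' : insert v (N i v) = univ := by ext; simp [hu]
    rw [hu', Finset.card_univ, h.cV] at hcard
    omega
  obtain ⟨u, hu⟩ := this
  simp only [Finset.mem_insert, not_or] at hu
  have h3 := h.ore v u (Ne.symm hu.1) i hu.2 i i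
  have h4 : (N i u) ⊆ univ \ {u, v} := by
    intro y hy
    simp only [Finset.mem_sdiff, Finset.mem_univ, true_and, Finset.mem_insert,
      Finset.mem_singleton, not_or]
    refine ⟨h.ne hy, ?_⟩
    rintro rfl
    exact hu.2 (h.symm _ _ _ hy)
  have h5 := Finset.card_le_card h4
  rw [Finset.card_sdiff_of_subset (Finset.subset_univ _), Finset.card_pair hu.1,
    Finset.card_univ, h.cV] at h5
  omega

/-- Four vertices with pairwise disjoint traces of neighbourhoods on `T`. -/
lemma Fam.four (h : Fam n N) (T : Finset V) (hTc : T.card + 2 = n)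
    (hT : ∀ r u, (N r u).card ≤ (N r u ∩ T).card + 2)
    (u1 u2 u3 u4 : V) (r1 r2 r3 r4 : ι)
    (m1 : u1 ∈ T) (m2 : u2 ∈ T) (m3 : u3 ∈ T) (m4 : u4 ∈ T)
    (n12 : u1 ≠ u2) (n13 : u1 ≠ u3) (n14 : u1 ≠ u4) (n23 : u2 ≠ u3) (n24 : u2 ≠ u4)
    (n34 : u3 ≠ u4)
    (d12 : ∀ t ∈ T, t ∈ N r1 u1 → t ∉ N r2 u2)
    (d13 : ∀ t ∈ T, t ∈ N r1 u1 → t ∉ N r3 u3)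
    (d14 : ∀ t ∈ T, t ∈ N r1 u1 → t ∉ N r4 u4)
    (d23 : ∀ t ∈ T, t ∈ N r2 u2 → t ∉ N r3 u3)
    (d24 : ∀ t ∈ T, t ∈ N r2 u2 → t ∉ N r4 u4)
    (d34 : ∀ t ∈ T, t ∈ N r3 u3 → t ∉ N r4 u4) : False := by
  have hn := h.hn
  have a12 : Disjoint (N r1 u1 ∩ T) (N r2 u2 ∩ T) := by
    rw [Finset.disjoint_left]; intro t ht ht'
    rw [Finset.mem_inter] at ht ht'; exact d12 t ht.2 ht.1 ht'.1
  have a34 : Disjoint (N r3 u3 ∩ T) (N r4 u4 ∩ T) := by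
    rw [Finset.disjoint_left]; intro t ht ht'
    rw [Finset.mem_inter] at ht ht'; exact d34 t ht.2 ht.1 ht'.1
  have a : Disjoint ((N r1 u1 ∩ T) ∪ (N r2 u2 ∩ T)) ((N r3 u3 ∩ T) ∪ (N r4 u4 ∩ T)) := by
    rw [Finset.disjoint_left]; intro t ht ht'
    simp only [Finset.mem_union, Finset.mem_inter] at ht ht'
    rcases ht with ht | ht <;> rcases ht' with ht' | ht'
    · exact d13 t ht.2 ht.1 ht'.1
    · exact d14 t ht.2 ht.1 ht'.1
    · exact d23 t ht.2 ht.1 ht'.1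
    · exact d24 t ht.2 ht.1 ht'.1
  have hsub : ((N r1 u1 ∩ T) ∪ (N r2 u2 ∩ T)) ∪ ((N r3 u3 ∩ T) ∪ (N r4 u4 ∩ T)) ⊆ T := by
    intro t ht
    simp only [Finset.mem_union, Finset.mem_inter] at ht
    tauto
  have hc := Finset.card_le_card hsub
  rw [Finset.card_union_of_disjoint a, Finset.card_union_of_disjoint a12,
    Finset.card_union_of_disjoint a34] at hc
  have b1 := hT r1 u1
  have b2 := hT r2 u2
  have b3 := hT r3 u3
  have b4 := hT r4 u4
  -- a non-full pair has large degree sum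
  have key : ∀ u v : V, u ≠ v → ∀ r s, (∀ i, v ∈ N i u) ∨ n ≤ (N r u).card + (N s v).card := by
    intro u v huv r s
    by_cases hf : ∀ i, v ∈ N i u
    · exact Or.inl hf
    · push Not at hf
      obtain ⟨i, hi⟩ := hf
      exact Or.inr (h.ore u v huv i hi r s)
  have k12 := key u1 u2 n12 r1 r2
  have k34 := key u3 u4 n34 r3 r4
  have k13 := key u1 u3 n13 r1 r3
  have k24 := key u2 u4 n24 r2 r4
  have sy := h.symm
  rcases k12 with k12 | k12
  · rcases k13 with k13 | k13
    · exact d23 u1 m1 (sy _ _ _ (k12 r2)) (sy _ _ _ (k13 r3))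
    · rcases k24 with k24 | k24
      · exact d14 u2 m2 (k12 r1) (sy _ _ _ (k24 r4))
      · omega
  · rcases k34 with k34 | k34
    · rcases k13 with k13 | k13
      · exact d14 u3 m3 (k13 r1) (sy _ _ _ (k34 r4))
      · rcases k24 with k24 | k24
        · exact d23 u4 m4 (k24 r2) (k34 r3)
        · omega
    · omega

/-- The last sub-case of Case I : `P` has two elements. -/
lemma Fam.small (h : Fam n N) (T P Q : Finset V) (i p q : ι) (x : V) (hPT : P ⊆ T)
    (hTc : T.card + 2 = n) (hP : P.card ≤ 2) (hQ : Q = T) (hP0 : P.Nonempty)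
    (hx : ∀ v ∈ T, v ∉ P → v ≠ x ∧ x ∉ N p v) (hd : (N p x).card = P.card)
    (key : ∀ r s, r ≠ i → r ≠ p → r ≠ q → s ≠ i → s ≠ p → s ≠ q → r ≠ s →
      ∀ t ∈ T, ∀ y ∈ P, ∀ y' ∈ Q, y ≠ y' → t ∈ N r y → t ∈ N s y' → False)
    (hP2 : P.card = 2) : False := by
  have hn := h.hn
  obtain ⟨r, hr⟩ := h.fresh {i, p, q} (lt_of_le_of_lt Finset.card_le_three (by norm_num))
  obtain ⟨s, hs⟩ := h.fresh {i, p, q, r} (lt_of_le_of_lt Finset.card_le_four (by norm_num))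
  simp only [Finset.mem_insert, Finset.mem_singleton, not_or] at hr hs
  have hTP : (T \ P).card + P.card = T.card := Finset.card_sdiff_add_card_eq_card hPT
  have : (T \ P).Nonempty := by
    rw [← Finset.card_pos]; omega
  obtain ⟨v, hv⟩ := this
  rw [Finset.mem_sdiff] at hv
  obtain ⟨hvx, hxv⟩ := hx v hv.1 hv.2
  have hdeg : ∀ c, n ≤ (N c v).card + 2 := by
    intro c
    have := h.ore v x hvx p hxv c p
    omega
  have hmiss : ∀ c, (univ \ N c v).card ≤ 2 := by
    intro c
    rw [Finset.card_sdiff_of_subset (Finset.subset_univ _), Finset.card_univ, h.cV]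
    have := hdeg c
    omega
  -- neighbour in P in colour r
  have h1 : ∃ y ∈ P, y ∈ N r v := by
    by_contra hcon
    push Not at hcon
    have hsub : insert v P ⊆ univ \ N r v := by
      intro y hy
      rw [Finset.mem_insert] at hy
      simp only [Finset.mem_sdiff, Finset.mem_univ, true_and]
      rcases hy with rfl | hy
      · exact h.irr _ _
      · exact hcon y hy
    have h3 := Finset.card_le_card hsub
    rw [Finset.card_insert_of_notMem hv.2] at h3
    have := hmiss r
    omega
  obtain ⟨y, hyP, hyv⟩ := h1
  have h2 : ∃ y' ∈ T, y' ≠ y ∧ y' ∈ N s v := by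
    by_contra hcon
    push Not at hcon
    have hsub : T.erase y ⊆ univ \ N s v := by
      intro y' hy
      rw [Finset.mem_erase] at hy
      simp only [Finset.mem_sdiff, Finset.mem_univ, true_and]
      exact hcon y' hy.2 hy.1
    have h3 := Finset.card_le_card hsub
    rw [Finset.card_erase_of_mem (hPT hyP)] at h3
    have := hmiss s
    omega
  obtain ⟨y', hy'T, hne, hy's⟩ := h2
  exact key r s (by tauto) (by tauto) (by tauto) (by tauto) (by tauto) (by tauto)
    (fun e => hs.2.2.2 e.symm) v hv.1 y hyP y' (hQ ▸ hy'T) hne.symm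
    (h.symm _ _ _ hyv) (h.symm _ _ _ hy's)

lemma Fam.caseI (h : Fam n N) (x b : V) (i p q : ι) (hip : i ≠ p) (hiq : i ≠ q) (hpq : p ≠ q)
    (hbi : b ∈ N i x) (hbp : b ∉ N p x) (hbq : b ∉ N q x) (hC : NoC N x) : False := by
  have hn := h.hn
  have hbx : b ≠ x := h.ne hbi
  set T : Finset V := univ \ {x, b} with hTdef
  have memT : ∀ v, v ∈ T ↔ v ≠ x ∧ v ≠ b := by
    intro v; simp [hTdef]
  have hTc : T.card + 2 = n := by
    rw [hTdef, Finset.card_sdiff_of_subset (Finset.subset_univ _), Finset.card_univ, h.cV,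
      Finset.card_pair hbx.symm]
    omega
  have hT : ∀ r u, (N r u).card ≤ (N r u ∩ T).card + 2 := by
    intro r u
    have hsub : N r u ⊆ (N r u ∩ T) ∪ {x, b} := by
      intro v hv
      simp only [Finset.mem_union, Finset.mem_inter, memT, Finset.mem_insert,
        Finset.mem_singleton]
      tauto
    calc _ ≤ _ := Finset.card_le_card hsub
      _ ≤ _ := Finset.card_union_le _ _
      _ ≤ _ := by rw [Finset.card_pair hbx.symm]
  have hxb : x ∉ N q b := fun hh => hbq (h.symm _ _ _ hh)
  set P := N p x with hP
  set Q := N q b with hQ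
  have hPT : P ⊆ T := by
    intro v hv
    rw [memT]
    exact ⟨h.ne hv, fun e => hbp (e ▸ hv)⟩
  have hQT : Q ⊆ T := by
    intro v hv
    rw [memT]
    exact ⟨fun e => hxb (e ▸ hv), h.ne hv⟩
  have hsum : n ≤ P.card + Q.card := h.ore x b hbx.symm p hbp p q
  have key : ∀ r s, r ≠ i → r ≠ p → r ≠ q → s ≠ i → s ≠ p → s ≠ q → r ≠ s →
      ∀ t ∈ T, ∀ y ∈ P, ∀ y' ∈ Q, y ≠ y' → t ∈ N r y → t ∈ N s y' → False := by
    intro r s ri rp rq si sp sq rs t ht y hy y' hy' hne h1 h2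
    rw [memT] at ht
    have hy1 := (memT _).1 (hPT hy)
    have hy2 := (memT _).1 (hQT hy')
    exact hC y t y' b p r s q i ht.1.symm hy2.1.symm hne hy1.2 ht.2 rp.symm sp.symm hpq hip.symm
      rs rq ri sq si hiq.symm hy h1 (h.symm _ _ _ h2) (h.symm _ _ _ hy') (h.symm _ _ _ hbi)
  obtain ⟨r1, hr1⟩ := h.fresh {i, p, q} (lt_of_le_of_lt Finset.card_le_three (by norm_num))
  obtain ⟨r2, hr2⟩ := h.fresh {i, p, q, r1} (lt_of_le_of_lt Finset.card_le_four (by norm_num))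
  obtain ⟨r3, hr3⟩ := h.fresh {i, p, q, r1, r2}
    (lt_of_le_of_lt Finset.card_le_five (by norm_num))
  obtain ⟨r4, hr4⟩ := h.fresh {i, p, q, r1, r2, r3}
    (lt_of_le_of_lt Finset.card_le_six (by norm_num))
  simp only [Finset.mem_insert, Finset.mem_singleton, not_or] at hr1 hr2 hr3 hr4
  have key' : ∀ r s, r ≠ i → r ≠ p → r ≠ q → s ≠ i → s ≠ p → s ≠ q → r ≠ s →
      ∀ y y', (y ∈ P ∧ y' ∈ Q) ∨ (y ∈ Q ∧ y' ∈ P) → y ≠ y' →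
      ∀ t ∈ T, t ∈ N r y → t ∉ N s y' := by
    intro r s ri rp rq si sp sq rs y y' hyy hne t ht h1 h2
    rcases hyy with hyy | hyy
    · exact key r s ri rp rq si sp sq rs t ht y hyy.1 y' hyy.2 hne h1 h2
    · exact key s r si sp sq ri rp rq rs.symm t ht y' hyy.2 y hyy.1 hne.symm h2 h1
  -- four pairwise compatible vertices are impossible
  have four : ∀ u1 u2 u3 u4 : V, u1 ∈ P → u1 ∈ Q → u2 ∈ P → u2 ∈ Q →
      u3 ∈ P → u4 ∈ Q → u1 ≠ u2 → u1 ≠ u3 → u1 ≠ u4 → u2 ≠ u3 → u2 ≠ u4 → u3 ≠ u4 → False := by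
    intro u1 u2 u3 u4 p1 q1 p2 q2 p3 q4 n12 n13 n14 n23 n24 n34
    obtain ⟨a1, a2, a3⟩ := hr1
    obtain ⟨b1, b2, b3, b4⟩ := hr2
    obtain ⟨c1, c2, c3, c4, c5⟩ := hr3
    obtain ⟨e1, e2, e3, e4, e5, e6⟩ := hr4
    exact h.four T hTc hT u1 u2 u3 u4 r1 r2 r3 r4 (hPT p1) (hPT p2) (hPT p3) (hQT q4)
      n12 n13 n14 n23 n24 n34
      (key' _ _ a1 a2 a3 b1 b2 b3 (Ne.symm b4) _ _ (Or.inl ⟨p1, q2⟩) n12)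
      (key' _ _ a1 a2 a3 c1 c2 c3 (Ne.symm c4) _ _ (Or.inr ⟨q1, p3⟩) n13)
      (key' _ _ a1 a2 a3 e1 e2 e3 (Ne.symm e4) _ _ (Or.inl ⟨p1, q4⟩) n14)
      (key' _ _ b1 b2 b3 c1 c2 c3 (Ne.symm c5) _ _ (Or.inr ⟨q2, p3⟩) n23)
      (key' _ _ b1 b2 b3 e1 e2 e3 (Ne.symm e5) _ _ (Or.inl ⟨p2, q4⟩) n24)
      (key' _ _ c1 c2 c3 e1 e2 e3 (Ne.symm e6) _ _ (Or.inl ⟨p3, q4⟩) n34)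
  have hUI : (P ∪ Q).card + (P ∩ Q).card = P.card + Q.card := Finset.card_union_add_card_inter P Q
  have hUT : (P ∪ Q).card ≤ T.card := Finset.card_le_card (Finset.union_subset hPT hQT)
  have hI2 : 1 < (P ∩ Q).card := by omega
  obtain ⟨z1, hz1, z2, hz2, hz12⟩ := Finset.one_lt_card.1 hI2
  rw [Finset.mem_inter] at hz1 hz2
  -- elements of P beyond z1 z2
  have hPz : ∀ S : Finset V, 2 < S.card → ∃ y ∈ S, y ≠ z1 ∧ y ≠ z2 := by
    intro S hS
    by_contra hcon
    push Not at hcon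
    have : S ⊆ {z1, z2} := by
      intro y hy
      simp only [Finset.mem_insert, Finset.mem_singleton]
      by_cases e : y = z1
      · exact Or.inl e
      · exact Or.inr (hcon y hy e)
    have := Finset.card_le_card this
    have h2 : ({z1, z2} : Finset V).card ≤ 2 := Finset.card_le_two
    omega
  by_cases hP2 : P.card ≤ 2
  · have hP2' : P.card = 2 := le_antisymm hP2 (h.two_le p x)
    have hQc : T.card ≤ Q.card := by omega
    have hQeq : Q = T := Finset.eq_of_subset_of_card_le hQT hQc
    refine h.small T P Q i p q x hPT hTc hP2 hQeq ⟨z1, hz1.1⟩ ?_ rfl key hP2'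
    intro v hv hvP
    exact ⟨((memT v).1 hv).1, fun hh => hvP (h.symm _ _ _ hh)⟩
  by_cases hQ2 : Q.card ≤ 2
  · have hQ2' : Q.card = 2 := le_antisymm hQ2 (h.two_le q b)
    have hPc : T.card ≤ P.card := by omega
    have hPeq : P = T := Finset.eq_of_subset_of_card_le hPT hPc
    refine h.small T Q P i q p b hQT hTc hQ2 hPeq ⟨z1, hz1.2⟩ ?_ rfl ?_ hQ2'
    · intro v hv hvP
      exact ⟨((memT v).1 hv).2, fun hh => hvP (h.symm _ _ _ hh)⟩
    · intro r s ri rq rp si sq sp rs t ht y hy y' hy' hne h1 h2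
      exact key s r si sp sq ri rp rq rs.symm t ht y' hy' y hy hne.symm h2 h1
  push Not at hP2 hQ2
  obtain ⟨y, hy, hy1, hy2⟩ := hPz P hP2
  obtain ⟨y', hy', hy1', hy2'⟩ := hPz Q hQ2
  by_cases hyy : y = y'
  · subst hyy
    -- three common elements; the union has at least four
    have h3 : ∃ w ∈ P ∪ Q, w ≠ z1 ∧ w ≠ z2 ∧ w ≠ y := by
      by_contra hcon
      push Not at hcon
      have hs : P ∪ Q ⊆ {z1, z2, y} := by
        intro w hw
        simp only [Finset.mem_insert, Finset.mem_singleton]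
        by_cases e1 : w = z1
        · exact Or.inl e1
        · by_cases e2 : w = z2
          · exact Or.inr (Or.inl e2)
          · exact Or.inr (Or.inr (hcon w hw e1 e2))
      have h5 := Finset.card_le_card hs
      have h6 : ({z1, z2, y} : Finset V).card ≤ 3 := Finset.card_le_three
      have h7 : (P ∩ Q).card ≤ (P ∪ Q).card :=
        Finset.card_le_card (Finset.inter_subset_left.trans Finset.subset_union_left)
      omega
    obtain ⟨w, hw, w1, w2, w3⟩ := h3
    rw [Finset.mem_union] at hw
    rcases hw with hw | hw
    · exact four z1 z2 w y hz1.1 hz1.2 hz2.1 hz2.2 hw hy' hz12 w1.symm hy1.symm w2.symm hy2.symm w3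
    · exact four z1 z2 y w hz1.1 hz1.2 hz2.1 hz2.2 hy hw hz12 hy1.symm w1.symm hy2.symm w2.symm
        w3.symm
  · exact four z1 z2 y y' hz1.1 hz1.2 hz2.1 hz2.2 hy hy' hz12 hy1.symm hy1'.symm hy2.symm
      hy2'.symm hyy

lemma exists_ne_of_card {A B : Finset V} (hA : 2 ≤ A.card) (hB : B.Nonempty) :
    ∃ a ∈ A, ∃ b ∈ B, a ≠ b := by
  obtain ⟨b, hb⟩ := hB
  obtain ⟨a, ha, hab⟩ := Finset.exists_mem_ne (by omega : 1 < A.card) b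
  exact ⟨a, ha, b, hb, hab⟩

lemma Fam.caseII (h : Fam n N) (x : V) (hC : NoC N x)
    (hII : ∀ v, v ≠ x → (∀ i, v ∉ N i x) ∨ ∃ j, ∀ i, i ≠ j → v ∈ N i x) :
    ∃ A : Finset V, 2 * A.card = n ∧ ∀ i u v, v ∈ N i u ↔ (u ∈ A ∧ v ∉ A) ∨ (u ∉ A ∧ v ∈ A) := by
  classical
  have hn := h.hn
  set D : Finset V := univ.filter (fun v => v ≠ x ∧ ∃ j, ∀ i, i ≠ j → v ∈ N i x) with hD
  set W : Finset V := univ.filter (fun v => v ≠ x ∧ ∀ i, v ∉ N i x) with hW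
  have memD : ∀ v, v ∈ D ↔ v ≠ x ∧ ∃ j, ∀ i, i ≠ j → v ∈ N i x := by intro v; simp [hD]
  have memW : ∀ v, v ∈ W ↔ v ≠ x ∧ ∀ i, v ∉ N i x := by intro v; simp [hW]
  have DW : ∀ v, v ∈ D → v ∉ W := by
    intro v hv hw
    rw [memD] at hv
    rw [memW] at hw
    obtain ⟨_, j, hj⟩ := hv
    obtain ⟨c, hc⟩ := h.fresh {j} (by simp)
    exact hw.2 c (hj c (by simpa using hc))
  have xD : x ∉ D := by simp [memD]
  have xW : x ∉ W := by simp [memW]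
  have cover : ∀ v, v ≠ x → v ∈ D ∨ v ∈ W := by
    intro v hv
    rw [memD, memW]
    rcases hII v hv with h1 | h1
    · exact Or.inr ⟨hv, h1⟩
    · exact Or.inl ⟨hv, h1⟩
  have hcard : D.card + W.card + 1 = n := by
    have hdis : Disjoint D W := Finset.disjoint_left.2 DW
    have hx : x ∉ D ∪ W := by simp [xD, xW]
    have hu : insert x (D ∪ W) = univ := by
      ext v
      simp only [Finset.mem_insert, Finset.mem_union, Finset.mem_univ, iff_true]
      by_cases e : v = x
      · exact Or.inl e
      · exact Or.inr (cover v e)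
    rw [← h.cV, ← Finset.card_univ, ← hu, Finset.card_insert_of_notMem hx,
      Finset.card_union_of_disjoint hdis]
  have NxD : ∀ i, N i x ⊆ D := by
    intro i v hv
    rcases cover v (h.ne hv) with h1 | h1
    · exact h1
    · exact absurd hv (((memW v).1 h1).2 i)
  -- no rainbow path with four vertices and both ends in `D`
  have P4 : ∀ a b c d r s t, a ∈ D → d ∈ D → a ≠ d → b ≠ x → c ≠ x → a ≠ c → b ≠ d →
      r ≠ s → r ≠ t → s ≠ t → b ∈ N r a → c ∈ N s b → d ∈ N t c → False := by
    intro a b c d r s t ha hd had hbx hcx hac hbd rs rt st h1 h2 h3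
    obtain ⟨_, ja, hja⟩ := (memD a).1 ha
    obtain ⟨_, jd, hjd⟩ := (memD d).1 hd
    obtain ⟨i, hi⟩ := h.fresh {r, s, t, ja} (lt_of_le_of_lt Finset.card_le_four (by norm_num))
    obtain ⟨m, hm⟩ := h.fresh {r, s, t, jd, i} (lt_of_le_of_lt Finset.card_le_five (by norm_num))
    simp only [Finset.mem_insert, Finset.mem_singleton, not_or] at hi hm
    obtain ⟨i1, i2, i3, i4⟩ := hi
    obtain ⟨m1, m2, m3, m4, m5⟩ := hm
    exact hC a b c d i r s t m hbx.symm hcx.symm hac had hbd i1 i2 i3 (Ne.symm m5) rs rt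
      (Ne.symm m1) st (Ne.symm m2) (Ne.symm m3) (hja i i4) h1 h2 h3 (h.symm _ _ _ (hjd m m4))
  have other : ∀ r s : ι, ∃ t, r ≠ t ∧ s ≠ t := by
    intro r s
    obtain ⟨t, ht⟩ := h.fresh {r, s} (lt_of_le_of_lt Finset.card_le_two (by norm_num))
    simp only [Finset.mem_insert, Finset.mem_singleton, not_or] at ht
    exact ⟨t, Ne.symm ht.1, Ne.symm ht.2⟩
  obtain ⟨c0, -⟩ := h.fresh ∅ (by simp)
  have Wx : ∀ w ∈ W, ∀ q, x ∉ N q w := by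
    intro w hw q hx
    exact ((memW w).1 hw).2 q (h.symm _ _ _ hx)
  have Wdeg : ∀ w ∈ W, ∀ q, n ≤ (N q w).card + D.card := by
    intro w hw q
    have h1 := h.ore w x ((memW w).1 hw).1 c0 (Wx w hw c0) q c0
    have h2 := Finset.card_le_card (NxD c0)
    omega
  have W2 : ∀ w ∈ W, ∀ q, 2 ≤ (N q w ∩ D).card := by
    intro w hw q
    have hsub : N q w ⊆ (N q w ∩ D) ∪ W.erase w := by
      intro v hv
      simp only [Finset.mem_union, Finset.mem_inter, Finset.mem_erase]
      rcases cover v (fun e => Wx w hw q (e ▸ hv)) with h1 | h1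
      · exact Or.inl ⟨hv, h1⟩
      · exact Or.inr ⟨h.ne hv, h1⟩
    have h1 := Finset.card_le_card hsub
    have h2 := Finset.card_union_le (N q w ∩ D) (W.erase w)
    rw [Finset.card_erase_of_mem hw] at h2
    have h3 := Wdeg w hw q
    have h4 : 0 < W.card := Finset.card_pos.2 ⟨w, hw⟩
    omega
  have Wind : ∀ w ∈ W, ∀ w' ∈ W, ∀ r, w' ∉ N r w := by
    intro b hb c hc r hr
    obtain ⟨s, hs, -⟩ := other r r
    obtain ⟨t, ht1, ht2⟩ := other r s
    obtain ⟨a, ha, d, hd, had⟩ := exists_ne_of_card (W2 b hb s)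
      (Finset.card_pos.1 (lt_of_lt_of_le (by norm_num) (W2 c hc t)))
    rw [Finset.mem_inter] at ha hd
    exact P4 a b c d s r t ha.2 hd.2 had ((memW b).1 hb).1 ((memW c).1 hc).1
      (fun e => DW a ha.2 (e ▸ hc)) (fun e => DW d hd.2 (e ▸ hb)) hs.symm ht2 ht1
      (h.symm _ _ _ ha.1) hr hd.1
  have WND : ∀ w ∈ W, ∀ q, N q w ⊆ D := by
    intro w hw q v hv
    rcases cover v (fun e => Wx w hw q (e ▸ hv)) with h1 | h1
    · exact h1
    · exact absurd hv (Wind w hw v h1 q)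
  by_cases hWc : W.card ≤ 1
  · exfalso
    have hDc : (univ \ D).card ≤ 2 := by
      rw [Finset.card_sdiff_of_subset (Finset.subset_univ _), Finset.card_univ, h.cV]
      omega
    have three : ∀ b ∈ D, (∀ s, 3 ≤ (N s b ∩ D).card) → False := by
      intro b hb hb3
      obtain ⟨c, hc, c', hc', hcc⟩ := Finset.one_lt_card.1
        (lt_of_lt_of_le (by norm_num) (hb3 c0) : 1 < (N c0 b ∩ D).card)
      rw [Finset.mem_inter] at hc hc'
      obtain ⟨t, ht, -⟩ := other c0 c0
      obtain ⟨s, hs1, hs2⟩ := other c0 t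
      have low : ∀ c ∈ D, c ∈ N c0 b → ∀ d ∈ N t c, d ∈ D → d = b := by
        intro c hcD hcb d hd hdD
        by_contra hdb
        have : ∃ a ∈ N s b ∩ D, a ≠ c ∧ a ≠ d := by
          by_contra hcon
          push Not at hcon
          have hsub : N s b ∩ D ⊆ {c, d} := by
            intro y hy
            simp only [Finset.mem_insert, Finset.mem_singleton]
            by_cases e : y = c
            · exact Or.inl e
            · exact Or.inr (hcon y hy e)
          have h1 := Finset.card_le_card hsub
          have h2 : ({c, d} : Finset V).card ≤ 2 := Finset.card_le_two
          have := hb3 s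
          omega
        obtain ⟨a, ha, hac, had⟩ := this
        rw [Finset.mem_inter] at ha
        exact P4 a b c d s c0 t ha.2 hdD had ((memD b).1 hb).1 ((memD c).1 hcD).1 hac
          (Ne.symm hdb) hs1.symm hs2.symm ht (h.symm _ _ _ ha.1) hcb hd
      have lowc : ∀ c ∈ D, c ∈ N c0 b → (N t c).card ≤ 3 := by
        intro c hcD hcb
        have hsub : N t c ⊆ insert b (univ \ D) := by
          intro d hd
          simp only [Finset.mem_insert, Finset.mem_sdiff, Finset.mem_univ, true_and]
          by_cases e : d ∈ D
          · exact Or.inl (low c hcD hcb d hd e)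
          · exact Or.inr e
        have h1 := Finset.card_le_card hsub
        have h2 := Finset.card_insert_le b (univ \ D)
        omega
      have h1 := lowc c hc.2 hc.1
      have h2 := lowc c' hc'.2 hc'.1
      have h3 : c' ∉ N t c := fun hh => h.ne hc'.1 (low c hc.2 hc.1 c' hh hc'.2)
      have := h.ore c c' hcc t h3 t t
      omega
    have low : ∀ b ∈ D, ∃ s, (N s b).card ≤ 3 := by
      intro b hb
      by_contra hcon
      push Not at hcon
      have hcon : ∀ s, 4 ≤ (N s b).card := fun s => hcon s
      have h2 : ∀ s, 2 ≤ (N s b ∩ D).card := by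
        intro s
        have hsub : N s b ⊆ (N s b ∩ D) ∪ (univ \ D) := by
          intro v hv
          simp only [Finset.mem_union, Finset.mem_inter, Finset.mem_sdiff, Finset.mem_univ,
            true_and]
          tauto
        have h3 := Finset.card_le_card hsub
        have h4 := Finset.card_union_le (N s b ∩ D) (univ \ D)
        have := hcon s
        omega
      have hbW : ∀ w ∈ W, ∀ r, w ∉ N r b := by
        intro w hw r hr
        obtain ⟨s, hs, -⟩ := other r r
        obtain ⟨t, ht1, ht2⟩ := other r s
        have hne : ((N t w ∩ D).erase b).Nonempty := by
          rw [← Finset.card_pos]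
          have h5 := Finset.pred_card_le_card_erase (s := N t w ∩ D) (a := b)
          have := W2 w hw t
          omega
        obtain ⟨a, ha, d, hd, had⟩ := exists_ne_of_card (h2 s) hne
        rw [Finset.mem_erase, Finset.mem_inter] at hd
        rw [Finset.mem_inter] at ha
        exact P4 a b w d s r t ha.2 hd.2.2 had ((memD b).1 hb).1 ((memW w).1 hw).1
          (fun e => DW a ha.2 (e ▸ hw)) hd.1.symm hs.symm ht2 ht1
          (h.symm _ _ _ ha.1) hr hd.2.1
      apply three b hb
      intro s
      have hsub : N s b ⊆ insert x (N s b ∩ D) := by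
        intro v hv
        simp only [Finset.mem_insert, Finset.mem_inter]
        by_cases e : v = x
        · exact Or.inl e
        · rcases cover v e with h1 | h1
          · exact Or.inr ⟨hv, h1⟩
          · exact absurd hv (hbW v h1 s)
      have h3 := Finset.card_le_card hsub
      have h4 := Finset.card_insert_le x (N s b ∩ D)
      have := hcon s
      omega
    have full : ∀ b ∈ D, ∀ b' ∈ D, b ≠ b' → ∀ i, b' ∈ N i b := by
      intro b hb b' hb' hne i
      by_contra hcon
      obtain ⟨s, hs⟩ := low b hb
      obtain ⟨s', hs'⟩ := low b' hb'
      have := h.ore b b' hne i hcon s s'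
      omega
    have : D.Nonempty := by rw [← Finset.card_pos]; omega
    obtain ⟨b, hb⟩ := this
    obtain ⟨s, hs⟩ := low b hb
    have hsub : D.erase b ⊆ N s b := by
      intro v hv
      rw [Finset.mem_erase] at hv
      exact full b hb v hv.2 hv.1.symm s
    have h1 := Finset.card_le_card hsub
    rw [Finset.card_erase_of_mem hb] at h1
    omega
  · push Not at hWc
    obtain ⟨w0, hw0, w1, hw1, hw01⟩ := Finset.one_lt_card.1 hWc
    have noD : ∀ b ∈ D, ∀ w ∈ W, ∀ r, w ∈ N r b → ∀ s, r ≠ s → ∀ a ∈ N s b, a ∉ D := by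
      intro b hb w hw r hr s hrs a ha haD
      obtain ⟨t, ht1, ht2⟩ := other r s
      have : ∃ d ∈ N t w, d ≠ a ∧ d ≠ b := by
        by_contra hcon
        push Not at hcon
        have hsub : N t w ⊆ {a, b} := by
          intro y hy
          simp only [Finset.mem_insert, Finset.mem_singleton]
          by_cases e : y = a
          · exact Or.inl e
          · exact Or.inr (hcon y hy e)
        have h1 := Finset.card_le_card hsub
        have h2 : ({a, b} : Finset V).card ≤ 2 := Finset.card_le_two
        have := Wdeg w hw t
        omega
      obtain ⟨d, hd, hda, hdb⟩ := this
      exact P4 a b w d s r t haD (WND w hw t hd) hda.symm ((memD b).1 hb).1 ((memW w).1 hw).1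
        (fun e => DW a haD (e ▸ hw)) hdb.symm hrs.symm ht2 ht1 (h.symm _ _ _ ha) hr hd
    have noD2 : ∀ b ∈ D, ∀ w ∈ W, ∀ r, w ∈ N r b → ∀ s, ∀ a ∈ N s b, a ∉ D := by
      intro b hb w hw r hr s
      by_cases hrs : r = s
      · subst hrs
        obtain ⟨s', hs', -⟩ := other r r
        obtain ⟨w', hw', hne⟩ := Finset.exists_mem_ne
          (lt_of_lt_of_le (by norm_num) (h.two_le s' b) : 1 < (N s' b).card) x
        rcases cover w' hne with h1 | h1
        · exact absurd h1 (noD b hb w hw r hr s' hs' w' hw')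
        · exact noD b hb w' h1 s' hw' r hs'.symm
      · exact noD b hb w hw r hr s hrs
    have hasW : ∀ b ∈ D, ∃ w ∈ W, ∃ r, w ∈ N r b := by
      intro b hb
      by_contra hcon
      push Not at hcon
      have hne : b ≠ w0 := fun e => DW b hb (e ▸ hw0)
      have h1 := h.ore b w0 hne c0 (hcon w0 hw0 c0) c0 c0
      have hsub1 : (N c0 b).erase x ⊆ D := by
        intro v hv
        rw [Finset.mem_erase] at hv
        rcases cover v hv.1 with h2 | h2
        · exact h2
        · exact absurd hv.2 (hcon v h2 c0)
      have hdis : Disjoint ((N c0 b).erase x) (N c0 w0) := by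
        rw [Finset.disjoint_left]
        intro y hy hy'
        have hyD := hsub1 hy
        rw [Finset.mem_erase] at hy
        exact noD2 y hyD w0 hw0 c0 (h.symm _ _ _ hy') c0 b (h.symm _ _ _ hy.2) hb
      have h2 := Finset.card_le_card (Finset.union_subset hsub1 (WND w0 hw0 c0))
      rw [Finset.card_union_of_disjoint hdis] at h2
      have h3 := Finset.pred_card_le_card_erase (s := N c0 b) (a := x)
      omega
    have Dind : ∀ b ∈ D, ∀ s, ∀ a ∈ N s b, a ∉ D := by
      intro b hb
      obtain ⟨w, hw, r, hr⟩ := hasW b hb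
      exact noD2 b hb w hw r hr
    have DN : ∀ b ∈ D, ∀ s, N s b ⊆ univ \ D := by
      intro b hb s a ha
      simp only [Finset.mem_sdiff, Finset.mem_univ, true_and]
      exact Dind b hb s a ha
    have cDc : (univ \ D).card + D.card = n := by
      rw [Finset.card_sdiff_add_card_eq_card (Finset.subset_univ _), Finset.card_univ, h.cV]
    have Dup : ∀ b ∈ D, ∀ s, (N s b).card + D.card ≤ n := by
      intro b hb s
      have := Finset.card_le_card (DN b hb s)
      omega
    have hw0d := Wdeg w0 hw0 c0
    have hw0u := Finset.card_le_card (WND w0 hw0 c0)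
    have D2 : 1 < D.card := by omega
    have hDD : ∀ b ∈ D, ∀ s, n ≤ (N s b).card + D.card ∧ 2 * D.card = n := by
      intro b hb s
      obtain ⟨b', hb', hne⟩ := Finset.exists_mem_ne D2 b
      have h1 := h.ore b b' hne.symm s (fun hh => Dind b hb s b' hh hb') s s
      have h2 := Dup b hb s
      have h3 := Dup b' hb' s
      omega
    have DNeq : ∀ b ∈ D, ∀ s, N s b = univ \ D := by
      intro b hb s
      apply Finset.eq_of_subset_of_card_le (DN b hb s)
      have := (hDD b hb s).1
      omega
    have ndD : ∀ u, u ∉ D → ∀ s, N s u ⊆ D := by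
      intro u hu s
      by_cases e : u = x
      · subst e; exact NxD s
      · rcases cover u e with h1 | h1
        · exact absurd h1 hu
        · exact WND u h1 s
    obtain ⟨b, hb⟩ : D.Nonempty := by rw [← Finset.card_pos]; omega
    refine ⟨D, (hDD b hb c0).2, ?_⟩
    intro i u v
    by_cases hu : u ∈ D
    · rw [DNeq u hu i]
      simp [hu]
    · constructor
      · intro hv
        exact Or.inr ⟨hu, ndD u hu i hv⟩
      · rintro (h1 | h1)
        · exact absurd h1.1 hu
        · apply h.symm
          rw [DNeq v h1.2 i]
          simp [hu]

lemma Fam.main (h : Fam n N) (x : V) (hC : NoC N x) :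
    ∃ A : Finset V, 2 * A.card = n ∧
      ∀ i u v, v ∈ N i u ↔ (u ∈ A ∧ v ∉ A) ∨ (u ∉ A ∧ v ∈ A) := by
  apply h.caseII x hC
  intro v _
  by_contra hcon
  push Not at hcon
  obtain ⟨⟨i, hi⟩, h2⟩ := hcon
  obtain ⟨p, -, hp⟩ := h2 i
  obtain ⟨q, hqp, hq⟩ := h2 p
  exact h.caseI x v i p q (fun e => hp (e ▸ hi)) (fun e => hq (e ▸ hi)) hqp.symm hi hp hq hC

end

lemma inj5 {α : Type*} (a b c d e : α) (ab : a ≠ b) (ac : a ≠ c) (ad : a ≠ d) (ae : a ≠ e)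
    (bc : b ≠ c) (bd : b ≠ d) (be : b ≠ e) (cd : c ≠ d) (ce : c ≠ e) (de : d ≠ e) :
    Function.Injective (![a, b, c, d, e] : Fin 5 → α) := by
  have hl : [a, b, c, d, e].Nodup := by
    simp [ab, ac, ad, ae, bc, bd, be, cd, ce, de]
  have h2 := List.nodup_iff_injective_get.1 hl
  intro y z hyz
  apply h2
  fin_cases y <;> fin_cases z <;> first | rfl | exact hyz

end Rainbow5

theorem stmt12 {V : Type*} [Fintype V] {n : ℕ} (hn : 8 ≤ n)
    (hV : Fintype.card V = n)
    (G : ZMod n → SimpleGraph V) [∀ i, DecidableRel (G i).Adj]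
    (hσ : ∀ u v : V, u ≠ v → (∃ i, ¬ (G i).Adj u v) →
      ∀ p q, n ≤ (G p).degree u + (G q).degree v) :
    (∀ x : V, HasRainbowCycleThrough G 5 x) ∨
    (Even n ∧ ∃ A : Finset V, 2 * A.card = n ∧
      ∀ (i : ZMod n) (u v : V), (G i).Adj u v ↔
        ((u ∈ A ∧ v ∉ A) ∨ (u ∉ A ∧ v ∈ A))) := by
  classical
  have hne : NeZero n := ⟨by omega⟩
  have hdeg : ∀ i v, ((Finset.univ : Finset V).filter (fun u => (G i).Adj v u)).card
      = (G i).degree v := by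
    intro i v
    rw [← SimpleGraph.card_neighborFinset_eq_degree]
    congr 1
    ext u
    simp
  have hF : Rainbow5.Fam n (fun (i : ZMod n) v =>
      (Finset.univ : Finset V).filter (fun u => (G i).Adj v u)) := by
    refine ⟨hn, hV, ZMod.card n, ?_, ?_, ?_⟩
    · intro i u v huv
      simp only [Finset.mem_filter, Finset.mem_univ, true_and] at huv ⊢
      exact huv.symm
    · intro i v
      simp
    · intro u v huv i hi p q
      simp only [Finset.mem_filter, Finset.mem_univ, true_and] at hi
      simp only [hdeg]
      exact hσ u v huv ⟨i, hi⟩ p q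
  by_cases hall : ∀ x : V, HasRainbowCycleThrough G 5 x
  · exact Or.inl hall
  · right
    push Not at hall
    obtain ⟨x, hx⟩ := hall
    obtain ⟨A, hA, hA2⟩ := hF.main x (by
      intro a b c d i j k l m xb xc ac ad bd ij ik il im jk jl jm kl km lm h1 h2 h3 h4 h5
      simp only [Finset.mem_filter, Finset.mem_univ, true_and] at h1 h2 h3 h4 h5
      apply hx
      have e1 := h1.ne
      have e2 := h2.ne
      have e3 := h3.ne
      have e4 := h4.ne
      have e5 := h5.ne
      refine ⟨(![x, a, b, c, d] : Fin 5 → V), (![i, j, k, l, m] : Fin 5 → ZMod n),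
        ⟨?_, ?_, ?_⟩, (0 : Fin 5), rfl⟩
      · exact Rainbow5.inj5 _ _ _ _ _ e1 xb xc e5.symm e2 ac ad e3 bd e4
      · exact Rainbow5.inj5 _ _ _ _ _ ij ik il im jk jl jm kl km lm
      · intro y
        change Fin 5 at y
        fin_cases y
        · exact h1
        · exact h2
        · exact h3
        · exact h4
        · exact h5)
    refine ⟨⟨A.card, by omega⟩, A, hA, ?_⟩
    intro i u v
    have := hA2 i u v
    simpa only [Finset.mem_filter, Finset.mem_univ, true_and] using this
end

section
/- Let n ≥ 8 and let 𝒢 = {G_1, …, G_n} be a family of n graphs (not necessarily distinct) on a common vertex set V with |V| = n. If σ(𝒢) ≥ n, then every vertex of V is contained in a rainbow cycle of length 4 in 𝒢. -/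
theorem mk_rainbow {V ι : Type*} (G : ι → SimpleGraph V) {x a w b : V} {i p q j : ι}
    (hxw : x ≠ w) (hab : a ≠ b) (hip : i ≠ p) (hiq : i ≠ q) (hij : i ≠ j)
    (hpq : p ≠ q) (hpj : p ≠ j) (hqj : q ≠ j)
    (h1 : (G i).Adj x a) (h2 : (G p).Adj a w) (h3 : (G q).Adj w b) (h4 : (G j).Adj b x) :
    HasRainbowCycleThrough G 4 x := by
  have e1 := h1.ne
  have e2 := h2.ne
  have e3 := h3.ne
  have e4 := h4.ne
  refine ⟨(![x, a, w, b] : Fin 4 → V), (![i, p, q, j] : Fin 4 → ι), ⟨?_, ?_, ?_⟩, (0 : Fin 4), rfl⟩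
  · intro (s : Fin 4) (t : Fin 4) h
    fin_cases s <;> fin_cases t <;> first | rfl | (exfalso; simp at h; grind)
  · intro (s : Fin 4) (t : Fin 4) h
    fin_cases s <;> fin_cases t <;> first | rfl | (exfalso; simp at h; grind)
  · intro (s : Fin 4)
    fin_cases s
    · exact h1
    · exact h2
    · exact h3
    · exact h4

theorem fresh_elt {α : Type*} [Fintype α] (s : Finset α) (h : s.card < Fintype.card α) :
    ∃ j, j ∉ s := by
  by_contra! hc
  have : s = Finset.univ := Finset.eq_univ_iff_forall.2 hc
  rw [this, Finset.card_univ] at h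
  omega

theorem count_inter {V : Type*} [Fintype V] [DecidableEq V] (A B : SimpleGraph V)
    [DecidableRel A.Adj] [DecidableRel B.Adj] {x w : V} (hxw : x ≠ w)
    (hA : ¬ A.Adj x w) (hd : Fintype.card V ≤ B.degree x + A.degree w) :
    1 ≤ (A.neighborFinset w ∩ B.neighborFinset x).card ∧
    (¬ B.Adj x w → 2 ≤ (A.neighborFinset w ∩ B.neighborFinset x).card) := by
  have h := Finset.card_union_add_card_inter (A.neighborFinset w) (B.neighborFinset x)
  rw [SimpleGraph.card_neighborFinset_eq_degree, SimpleGraph.card_neighborFinset_eq_degree] at h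
  have c1 : (A.neighborFinset w ∪ B.neighborFinset x).card ≤ (Finset.univ.erase x).card := by
    apply Finset.card_le_card
    intro y hy
    simp only [Finset.mem_union, SimpleGraph.mem_neighborFinset, Finset.mem_erase,
      Finset.mem_univ, and_true] at hy ⊢
    rintro rfl
    rcases hy with hy | hy
    · exact hA hy.symm
    · exact hy.ne rfl
  rw [Finset.card_erase_of_mem (Finset.mem_univ _), Finset.card_univ] at c1
  have : 0 < Fintype.card V := Fintype.card_pos_iff.2 ⟨x⟩
  refine ⟨by omega, fun hB => ?_⟩
  have c2 : (A.neighborFinset w ∪ B.neighborFinset x).card ≤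
      ((Finset.univ.erase x).erase w).card := by
    apply Finset.card_le_card
    intro y hy
    simp only [Finset.mem_union, SimpleGraph.mem_neighborFinset, Finset.mem_erase,
      Finset.mem_univ, and_true] at hy ⊢
    constructor
    · rintro rfl
      rcases hy with hy | hy
      · exact hy.ne rfl
      · exact hB hy
    · rintro rfl
      rcases hy with hy | hy
      · exact hA hy.symm
      · exact hy.ne rfl
  rw [Finset.card_erase_of_mem (by simp [hxw.symm]),
    Finset.card_erase_of_mem (Finset.mem_univ _), Finset.card_univ] at c2
  have : 1 < Fintype.card V := Fintype.one_lt_card_iff.2 ⟨x, w, hxw⟩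
  omega

theorem stmt13 {V : Type*} [Fintype V] {n : ℕ} (hn : 8 ≤ n)
    (hV : Fintype.card V = n)
    (G : ZMod n → SimpleGraph V) [∀ i, DecidableRel (G i).Adj]
    (hσ : ∀ u v : V, u ≠ v → (∃ i, ¬ (G i).Adj u v) →
      ∀ p q, n ≤ (G p).degree u + (G q).degree v) :
    ∀ x : V, HasRainbowCycleThrough G 4 x := by
  classical
  intro x
  by_contra hno
  haveI : NeZero n := ⟨by omega⟩
  have hZ : Fintype.card (ZMod n) = n := ZMod.card n
  -- every vertex is non-adjacent to `x` in at most two members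
  have hT : ∀ w, w ≠ x → (Finset.univ.filter fun i => ¬ (G i).Adj x w).card ≤ 2 := by
    intro w hw
    by_contra! hc
    obtain ⟨p, i, q, hp, hi, hq, hpi, hpq, hiq⟩ := Finset.two_lt_card_iff.1 hc
    simp only [Finset.mem_filter, Finset.mem_univ, true_and] at hp hi hq
    obtain ⟨j, hj⟩ := fresh_elt ({p, i, q} : Finset (ZMod n)) (by
      have := Finset.card_le_three (a := p) (b := i) (c := q)
      omega)
    simp only [Finset.mem_insert, Finset.mem_singleton, not_or] at hj
    have hd := hσ x w hw.symm ⟨p, hp⟩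
    have k1 := (count_inter (G p) (G i) hw.symm hp (hV ▸ hd i p)).2 hi
    have k2 := (count_inter (G q) (G j) hw.symm hq (hV ▸ hd j q)).1
    obtain ⟨b, hb⟩ := Finset.card_pos.1 (by omega :
      0 < ((G q).neighborFinset w ∩ (G j).neighborFinset x).card)
    obtain ⟨a, ha, hab⟩ := Finset.exists_mem_ne (by omega :
      1 < ((G p).neighborFinset w ∩ (G i).neighborFinset x).card) b
    simp only [Finset.mem_inter, SimpleGraph.mem_neighborFinset] at ha hb
    exact hno (mk_rainbow G hw.symm hab hpi.symm hiq (Ne.symm hj.2.1) hpq (Ne.symm hj.1)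
      (Ne.symm hj.2.2) ha.2 ha.1.symm hb.1 hb.2.symm)
  -- no rainbow path with two edges avoiding `x`
  have H : ∀ w a b p q, w ≠ x → a ≠ x → b ≠ x → a ≠ b → p ≠ q →
      (G p).Adj a w → (G q).Adj w b → False := by
    intro w a b p q hw ha hb hab hpq h2 h3
    obtain ⟨i, hi⟩ := fresh_elt ({p, q} ∪ Finset.univ.filter fun i => ¬ (G i).Adj x a) (by
      have h1 := Finset.card_union_le {p, q} (Finset.univ.filter fun i => ¬ (G i).Adj x a)
      have := Finset.card_le_two (a := p) (b := q)
      have := hT a ha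
      omega)
    obtain ⟨j, hj⟩ := fresh_elt ({p, q, i} ∪ Finset.univ.filter fun i => ¬ (G i).Adj x b) (by
      have h1 := Finset.card_union_le {p, q, i} (Finset.univ.filter fun i => ¬ (G i).Adj x b)
      have := Finset.card_le_three (a := p) (b := q) (c := i)
      have := hT b hb
      omega)
    simp only [Finset.mem_union, Finset.mem_insert, Finset.mem_singleton, Finset.mem_filter,
      Finset.mem_univ, true_and, not_or, not_not] at hi hj
    exact hno (mk_rainbow G hw.symm hab hi.1.1 hi.1.2 (Ne.symm hj.1.2.2) hpq (Ne.symm hj.1.1)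
      (Ne.symm hj.1.2.1) hi.2 h2 h3 hj.2.symm)
  obtain ⟨p, hp⟩ := fresh_elt (∅ : Finset (ZMod n)) (by simp; omega)
  obtain ⟨q, hq⟩ := fresh_elt ({p} : Finset (ZMod n)) (by simp; omega)
  have hpq : p ≠ q := by
    rintro rfl
    simp at hq
  have hdeg : ∀ w, w ≠ x → ∃ r, (G r).degree w ≤ 2 := by
    intro w hw
    by_contra! hc
    have h1 := hc p
    have h2 := hc q
    rw [← SimpleGraph.card_neighborFinset_eq_degree] at h1 h2
    obtain ⟨b, hb, hbx⟩ := Finset.exists_mem_ne (by omega : 1 < ((G q).neighborFinset w).card) x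
    obtain ⟨a, ha, hax⟩ := Finset.exists_mem_notMem_of_card_lt_card
      (s := {x, b}) (t := (G p).neighborFinset w) (by
        have := Finset.card_le_two (a := x) (b := b)
        omega)
    simp only [SimpleGraph.mem_neighborFinset, Finset.mem_insert, Finset.mem_singleton,
      not_or] at ha hb hax
    exact H w a b p q hw hax.1 hbx hax.2 hpq ha.symm hb
  have hall : ∀ u w, u ≠ x → w ≠ x → u ≠ w → ∀ r, (G r).Adj u w := by
    intro u w hu hw huw r
    by_contra hr
    obtain ⟨s, hs⟩ := hdeg u hu
    obtain ⟨t, ht⟩ := hdeg w hw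
    have := hσ u w huw ⟨r, hr⟩ s t
    omega
  obtain ⟨a, ha⟩ := fresh_elt ({x} : Finset V) (by simp; omega)
  obtain ⟨w, hw⟩ := fresh_elt ({x, a} : Finset V) (by
    have := Finset.card_le_two (a := x) (b := a)
    omega)
  obtain ⟨b, hb⟩ := fresh_elt ({x, a, w} : Finset V) (by
    have := Finset.card_le_three (a := x) (b := a) (c := w)
    omega)
  simp only [Finset.mem_insert, Finset.mem_singleton, not_or] at ha hw hb
  exact H w a b p q hw.1 ha hb.1 (Ne.symm hb.2.1) hpq (hall a w ha hw.1 (Ne.symm hw.2) p)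
    (hall w b hw.1 hb.1 (Ne.symm hb.2.2) q)
end

section
/- Let n ≥ 4 and let 𝒢 = {G_1, …, G_n} be a family of n graphs (not necessarily distinct) on a common vertex set V with |V| = n. If σ(𝒢) ≥ 4n/3 − 1, then every vertex of V is contained in a rainbow triangle in 𝒢. -/
/-- Neighbourhood avoiding a set bounds the degree. -/
lemma degree_add_card_le {V : Type*} [Fintype V] [DecidableEq V] (H : SimpleGraph V)
    [DecidableRel H.Adj] (y : V) (A : Finset V) (h : ∀ z ∈ A, ¬ H.Adj y z) :
    H.degree y + A.card ≤ Fintype.card V := by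
  rw [← SimpleGraph.card_neighborFinset_eq_degree, ← Finset.card_union_of_disjoint]
  · exact Finset.card_le_univ _
  · rw [Finset.disjoint_left]
    intro z hz hA
    exact h z hA (by simpa using hz)

lemma rainbow_triangle {V ι : Type*} (G : ι → SimpleGraph V) (x y z : V) (i j k : ι)
    (hij : i ≠ j) (hik : i ≠ k) (hjk : j ≠ k)
    (h1 : (G i).Adj x y) (h2 : (G k).Adj y z) (h3 : (G j).Adj x z) :
    HasRainbowCycleThrough G 3 x := by
  refine ⟨(![x, y, z] : Fin 3 → V), (![i, k, j] : Fin 3 → ι), ⟨?_, ?_, ?_⟩, (0 : Fin 3), rfl⟩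
  · have a := h1.ne
    have b := h2.ne
    have c := h3.ne
    intro (p : Fin 3) (q : Fin 3) h
    fin_cases p <;> fin_cases q <;> first | rfl | (exfalso; simp_all)
  · intro (p : Fin 3) (q : Fin 3) h
    fin_cases p <;> fin_cases q <;> first | rfl | (exfalso; simp_all)
  · intro (p : Fin 3)
    fin_cases p
    · exact h1
    · exact h2
    · exact h3.symm

theorem stmt14 {V : Type*} [Fintype V] {n : ℕ} (hn : 4 ≤ n)
    (hV : Fintype.card V = n)
    (G : ZMod n → SimpleGraph V) [∀ i, DecidableRel (G i).Adj]
    (hσ : ∀ u v : V, u ≠ v → (∃ i, ¬ (G i).Adj u v) →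
      ∀ p q, (4 * (n : ℝ) / 3 - 1) ≤ ((G p).degree u + (G q).degree v : ℝ)) :
    ∀ x : V, HasRainbowCycleThrough G 3 x := by
  classical
  have hnat : ∀ u v : V, u ≠ v → (∃ i, ¬ (G i).Adj u v) →
      ∀ p q, 4 * n ≤ 3 * ((G p).degree u + (G q).degree v) + 3 := by
    intro u v huv h p q
    have := hσ u v huv h p q
    have h2 : (4 * n : ℝ) ≤ 3 * ((G p).degree u + (G q).degree v) + 3 := by linarith
    exact_mod_cast h2
  have hδ : ∀ (u : V) p, n + 3 ≤ 3 * (G p).degree u := by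
    intro u p
    by_cases h : ∃ v, u ≠ v ∧ ∃ i, ¬ (G i).Adj u v
    · obtain ⟨v, huv, i, hi⟩ := h
      have h1 := hnat u v huv ⟨i, hi⟩ p i
      have h2 := degree_add_card_le (G i) v {u, v} (by
        intro z hz
        simp only [Finset.mem_insert, Finset.mem_singleton] at hz
        rcases hz with rfl | rfl
        · exact fun h => hi h.symm
        · exact (G i).loopless.irrefl _)
      rw [Finset.card_pair huv] at h2
      omega
    · push Not at h
      have h1 : (G p).neighborFinset u = Finset.univ.erase u := by
        ext v
        simp only [SimpleGraph.mem_neighborFinset, Finset.mem_erase, Finset.mem_univ, and_true]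
        exact ⟨fun h => h.ne.symm, fun hv => h v hv.symm p⟩
      rw [← SimpleGraph.card_neighborFinset_eq_degree, h1,
        Finset.card_erase_of_mem (Finset.mem_univ _), Finset.card_univ]
      omega
  intro x
  by_contra hx
  obtain ⟨i, j, k, hij, hik, hjk⟩ : ∃ i j k : ZMod n, i ≠ j ∧ i ≠ k ∧ j ≠ k := by
    haveI : NeZero n := ⟨by omega⟩
    apply Fintype.two_lt_card_iff.mp
    rw [ZMod.card]
    omega
  have hno : ∀ y z, (G i).Adj x y → (G j).Adj x z → ¬ (G k).Adj y z :=
    fun y z h1 h3 h2 => hx (rainbow_triangle G x y z i j k hij hik hjk h1 h2 h3)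
  obtain ⟨y, hy⟩ : ((G i).neighborFinset x).Nonempty := by
    rw [← Finset.card_pos, SimpleGraph.card_neighborFinset_eq_degree]
    have := hδ x i
    omega
  obtain ⟨z, hz, hzy⟩ := Finset.exists_mem_ne (s := (G j).neighborFinset x) (by
    rw [SimpleGraph.card_neighborFinset_eq_degree]
    have := hδ x j
    omega) y
  rw [SimpleGraph.mem_neighborFinset] at hy hz
  have h1 := degree_add_card_le (G k) y ((G j).neighborFinset x)
    (fun w hw => hno y w hy (by simpa using hw))
  have h2 := degree_add_card_le (G k) z ((G i).neighborFinset x)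
    (fun w hw h => hno w z (by simpa using hw) hz h.symm)
  rw [SimpleGraph.card_neighborFinset_eq_degree] at h1 h2
  have h3 := hnat y z hzy.symm ⟨k, hno y z hy hz⟩ k k
  have h4 := hδ x i
  have h5 := hδ x j
  omega
end

section
/- Let n ≥ 4 with n ≡ 1 (mod 3), set t = (n + 2)/3 and m = (2n − 5)/3, and let G be the graph on an n-vertex set V obtained as the join of an independent set T of t vertices with the disjoint union of a single vertex x and a clique M of m vertices (so every vertex of T is adjacent to all of {x} ∪ M, the vertices of M are pairwise adjacent, x is adjacent to no vertex of M, and T is independent). Let 𝒢 = {G_1, …, G_n} with G_1 = ⋯ = G_n = G. Then σ(𝒢) ≥ (4n − 4)/3, but the vertex x is not contained in any rainbow triangle in 𝒢; in particular, σ(𝒢) ≥ (4n − 4)/3 does not guarantee that every vertex of V lies in a rainbow cycle of length 3. -/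
theorem stmt15 {V : Type*} [Fintype V] {n : ℕ} (hn : 4 ≤ n) (hmod : n % 3 = 1)
    (hV : Fintype.card V = n)
    (T M : Finset V) (x : V)
    (hT : 3 * T.card = n + 2) (hM : 3 * M.card = 2 * n - 5)
    (hxT : x ∉ T) (hxM : x ∉ M) (hTM : Disjoint T M)
    (hpart : ∀ v : V, v = x ∨ v ∈ T ∨ v ∈ M)
    (G : SimpleGraph V) [DecidableRel G.Adj]
    (hG : ∀ u v : V, G.Adj u v ↔
      (u ≠ v ∧ ((u ∈ T ↔ v ∉ T) ∨ (u ∈ M ∧ v ∈ M)))) :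
    (∀ u v : V, u ≠ v → ¬ G.Adj u v →
      ((4 * (n : ℝ) - 4) / 3 ≤ (G.degree u + G.degree v : ℝ))) ∧
    ¬ HasRainbowCycleThrough (fun _ : ZMod n => G) 3 x := by
  classical
  have hd : ∀ v ∈ T, v ∉ M := fun v h1 h2 => (Finset.disjoint_left.mp hTM) h1 h2
  have degT : ∀ u ∈ T, M.card + 1 ≤ G.degree u := by
    intro u hu
    rw [← Finset.card_insert_of_notMem hxM, ← SimpleGraph.card_neighborFinset_eq_degree]
    apply Finset.card_le_card
    intro v hv
    rw [SimpleGraph.mem_neighborFinset, hG]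
    rw [Finset.mem_insert] at hv
    have hvT : v ∉ T := by
      rcases hv with rfl | hv
      · exact hxT
      · exact fun h => hd v h hv
    refine ⟨fun h => hvT (h ▸ hu), Or.inl (by tauto)⟩
  have degx : T.card ≤ G.degree x := by
    rw [← SimpleGraph.card_neighborFinset_eq_degree]
    apply Finset.card_le_card
    intro v hv
    rw [SimpleGraph.mem_neighborFinset, hG]
    refine ⟨fun h => hxT (h ▸ hv), Or.inl (by tauto)⟩
  have degM : ∀ u ∈ M, T.card + M.card ≤ G.degree u + 1 := by
    intro u hu
    have huT : u ∉ T := fun h => hd u h hu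
    rw [← Finset.card_union_of_disjoint hTM, ← SimpleGraph.card_neighborFinset_eq_degree]
    have h1 : ((T ∪ M).erase u).card ≤ (G.neighborFinset u).card := by
      apply Finset.card_le_card
      intro v hv
      rw [SimpleGraph.mem_neighborFinset, hG]
      rw [Finset.mem_erase, Finset.mem_union] at hv
      refine ⟨fun h => hv.1 h.symm, ?_⟩
      tauto
    have h2 := Finset.card_erase_add_one (Finset.mem_union_right T hu)
    omega
  constructor
  · intro u v huv hadj
    have key : 4 * n ≤ 3 * (G.degree u + G.degree v) + 4 := by
      rw [hG] at hadj
      rcases hpart u with hu | hu | hu <;> rcases hpart v with hv | hv | hv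
      · exact absurd (hu.trans hv.symm) huv
      · subst hu; tauto
      · subst hu
        have := degM v hv
        omega
      · subst hv; tauto
      · have := degT u hu
        have := degT v hv
        omega
      · have := hd u hu
        have : v ∉ T := fun h => hd v h hv
        tauto
      · subst hv
        have := degM u hu
        omega
      · have := hd v hv
        have : u ∉ T := fun h => hd u h hu
        tauto
      · tauto
    have key' : (4 * n : ℝ) ≤ 3 * (G.degree u + G.degree v) + 4 := by exact_mod_cast key
    linarith
  · rintro ⟨c, φ, ⟨-, -, h⟩, i, hi⟩
    have h0 := h i
    have h1 := h (i + 1)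
    have h2 := h (i + 1 + 1)
    have e : i + 1 + 1 + 1 = i := (by decide : ∀ j : ZMod 3, j + 1 + 1 + 1 = j) i
    rw [e] at h2
    simp only [hG, hi] at h0 h1 h2
    have ha : c (i + 1) ∈ T := by tauto
    have hb : c (i + 1 + 1) ∈ T := by tauto
    have := hd _ ha
    tauto
end
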